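/- In the mixed even p-spin short-range model, assume the exponential volume growth condition: there are constants A > 0 and γ > 1 independent of N such that max_{i∈[N]} |B_r(i)| ≤ A γ^r for all r ∈ ℕ. Then there exists a constant C > 0 depending only on A and γ such that for every t > 0, every 0 ≤ β < ∞, and both the continuous and the discrete perturbation, E⟨R(σ,τ)²⟩_t ≤ C / N^{t/(t + log γ)}. -/

import Mathlib

open MeasureTheory ProbabilityTheory Real Finset

noncomputable section

/-! ### Basic objects: spins, Hermite polynomials, Gaussian measures -/

/-- The `±1` spin value attached to a Boolean. -/
def spin (b : Bool) : ℝ := if b then 1 else -1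

/-- Normalized Hermite polynomial `h_m = He_m / √(m!)`,
orthonormal w.r.t. the standard Gaussian measure. -/
def hermiteFn (m : ℕ) (x : ℝ) : ℝ :=
  Polynomial.aeval x (Polynomial.hermite m) / Real.sqrt (Nat.factorial m)

/-- The law of a family of i.i.d. standard Gaussians over a finite index set. -/
def gaussianPi (ι : Type*) [Fintype ι] : Measure (ι → ℝ) :=
  Measure.pi fun _ => gaussianReal 0 1

instance (ι : Type*) [Fintype ι] : IsProbabilityMeasure (gaussianPi ι) := by
  unfold gaussianPi; infer_instance

/-- Tensorized normalized Hermite polynomial `h_n(x) = ∏_e h_{n_e}(x_e)`. -/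
def hermiteProd {ι : Type*} [Fintype ι] (n : ι → ℕ) (x : ι → ℝ) : ℝ :=
  ∏ e, hermiteFn (n e) (x e)

/-- Continuous perturbation `J(t) = e^{-t} J + √(1-e^{-2t}) J'` of the disorder. -/
def contPerturb {ι : Type*} (t : ℝ) (J J' : ι → ℝ) : ι → ℝ := fun e =>
  Real.exp (-t) * J e + Real.sqrt (1 - Real.exp (-2 * t)) * J' e

/-- Discrete perturbation `J(t)_e = B_e J_e + (1-B_e) J'_e` of the disorder. -/
def discPerturb {ι : Type*} (J J' : ι → ℝ) (B : ι → Bool) : ι → ℝ := fun e =>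
  if B e then J e else J' e

/-- Bernoulli measure on `Bool` with success probability `p`. -/
def berBool (p : ℝ) : Measure Bool :=
  ENNReal.ofReal p • Measure.dirac true + ENNReal.ofReal (1 - p) • Measure.dirac false

instance (p : ℝ) : IsFiniteMeasure (berBool p) := by
  constructor
  simp only [berBool, Measure.coe_add, Pi.add_apply, Measure.smul_apply, smul_eq_mul,
    Measure.dirac_apply' _ MeasurableSet.univ, Set.indicator_univ, Pi.one_apply, mul_one]
  exact ENNReal.add_lt_top.mpr ⟨ENNReal.ofReal_lt_top, ENNReal.ofReal_lt_top⟩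

/-- Product Gaussian measure for a pair `(J, J')` of independent disorders. -/
def pairGauss (ι : Type*) [Fintype ι] : Measure ((ι → ℝ) × (ι → ℝ)) :=
  (gaussianPi ι).prod (gaussianPi ι)

/-- Product Gaussian measure for a triple of independent disorders. -/
def tripleGauss (ι : Type*) [Fintype ι] : Measure ((ι → ℝ) × (ι → ℝ) × (ι → ℝ)) :=
  (gaussianPi ι).prod ((gaussianPi ι).prod (gaussianPi ι))

/-- Law of `(J, J', B)`: two independent Gaussian disorders together with i.i.d.
Bernoulli(`p`) variables. -/
def tripleGaussBer (ι : Type*) [Fintype ι] (p : ℝ) :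
    Measure ((ι → ℝ) × (ι → ℝ) × (ι → Bool)) :=
  (gaussianPi ι).prod ((gaussianPi ι).prod (Measure.pi fun _ => berBool p))

/-! ### Spin models on hypergraphs -/

variable {N : ℕ}

/-- `σ_e = ∏_{v ∈ e} σ_v`. -/
def sigEdge (σ : Fin N → Bool) (e : Finset (Fin N)) : ℝ := ∏ v ∈ e, spin (σ v)

/-- Hamiltonian `H_J(σ) = Σ_e ρ_{|e|}(J_e) σ_e` of the short-range model. -/
def ham (Edges : Finset (Finset (Fin N))) (ρ : ℕ → ℝ → ℝ)
    (J : Finset (Fin N) → ℝ) (σ : Fin N → Bool) : ℝ :=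
  ∑ e ∈ Edges, ρ e.card (J e) * sigEdge σ e

/-- Gibbs average of an observable `f` for the Hamiltonian `H` at inverse temperature `β`. -/
def gibbs (β : ℝ) (H : (Fin N → Bool) → ℝ) (f : (Fin N → Bool) → ℝ) : ℝ :=
  (∑ σ : Fin N → Bool, f σ * Real.exp (β * H σ)) / ∑ σ : Fin N → Bool, Real.exp (β * H σ)

/-- Gibbs average of a two-replica observable `f(σ,τ)` where `σ, τ` are sampled from the
product of the Gibbs measures of the Hamiltonians `H₁`, `H₂`. -/
def gibbs2 (β : ℝ) (H₁ H₂ : (Fin N → Bool) → ℝ)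
    (f : (Fin N → Bool) → (Fin N → Bool) → ℝ) : ℝ :=
  (∑ σ : Fin N → Bool, ∑ τ : Fin N → Bool, f σ τ * Real.exp (β * H₁ σ + β * H₂ τ)) /
    ∑ σ : Fin N → Bool, ∑ τ : Fin N → Bool, Real.exp (β * H₁ σ + β * H₂ τ)

/-- Site overlap `R(σ,τ) = N⁻¹ Σ_i σ_i τ_i`. -/
def overlap (σ τ : Fin N → Bool) : ℝ := (∑ i, spin (σ i) * spin (τ i)) / N

/-- Fourier–Hermite coefficient `φ̂_{ij}(n) = E[⟨σ_i σ_j⟩ h_n(J)]` of the two-point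
correlation function. -/
def twoPointCoeff (Edges : Finset (Finset (Fin N))) (ρ : ℕ → ℝ → ℝ) (β : ℝ)
    (i j : Fin N) (n : Finset (Fin N) → ℕ) : ℝ :=
  ∫ ω, gibbs β (ham Edges ρ ω) (fun σ => spin (σ i) * spin (σ j)) * hermiteProd n ω
    ∂gaussianPi (Finset (Fin N))

/-- `E(n) = {e : n_e > 0}`. -/
def Esupp (n : Finset (Fin N) → ℕ) : Finset (Finset (Fin N)) :=
  Finset.univ.filter fun e => n e ≠ 0

/-- `V(n)`: the vertices covered by `E(n)`. -/
def Vsupp (n : Finset (Fin N) → ℕ) : Finset (Fin N) :=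
  (Esupp n).biUnion id

/-- Disorder-averaged two-replica observable under the continuous perturbation:
`E ⟨f(σ,τ)⟩_t` with `σ ~ G_J`, `τ ~ G_{J(t)}`. -/
def contExp (Edges : Finset (Finset (Fin N))) (ρ : ℕ → ℝ → ℝ) (β t : ℝ)
    (f : (Fin N → Bool) → (Fin N → Bool) → ℝ) : ℝ :=
  ∫ ω : (Finset (Fin N) → ℝ) × (Finset (Fin N) → ℝ),
    gibbs2 β (ham Edges ρ ω.1) (ham Edges ρ (contPerturb t ω.1 ω.2)) f
    ∂pairGauss (Finset (Fin N))

/-- Disorder-averaged two-replica observable under the discrete perturbation. -/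
def discExp (Edges : Finset (Finset (Fin N))) (ρ : ℕ → ℝ → ℝ) (β t : ℝ)
    (f : (Fin N → Bool) → (Fin N → Bool) → ℝ) : ℝ :=
  ∫ ω : (Finset (Fin N) → ℝ) × (Finset (Fin N) → ℝ) × (Finset (Fin N) → Bool),
    gibbs2 β (ham Edges ρ ω.1) (ham Edges ρ (discPerturb ω.1 ω.2.1 ω.2.2)) f
    ∂tripleGaussBer (Finset (Fin N)) (Real.exp (-t))

/-! ### Berge paths, distance, balls, cycles -/

/-- `(vs, es)` is a Berge path of length `ℓ` from `v` to `w` in the hypergraph `Edges`. -/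
def IsBergePath (Edges : Finset (Finset (Fin N))) (ℓ : ℕ)
    (vs : Fin (ℓ + 1) → Fin N) (es : Fin ℓ → Finset (Fin N)) (v w : Fin N) : Prop :=
  Function.Injective vs ∧ Function.Injective es ∧ (∀ k, es k ∈ Edges) ∧
    vs 0 = v ∧ vs (Fin.last ℓ) = w ∧
    ∀ k : Fin ℓ, vs k.castSucc ∈ es k ∧ vs k.succ ∈ es k

/-- Hypergraph (Berge) distance between two vertices, `∞` if there is no path. -/
def hdist (Edges : Finset (Finset (Fin N))) (v w : Fin N) : ℕ∞ :=
  sInf {d : ℕ∞ | ∃ (ℓ : ℕ) (vs : Fin (ℓ + 1) → Fin N) (es : Fin ℓ → Finset (Fin N)),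
    IsBergePath Edges ℓ vs es v w ∧ d = (ℓ : ℕ∞)}

open scoped Classical in
/-- The closed ball `B_r(v)` in the hypergraph distance. -/
def hball (Edges : Finset (Finset (Fin N))) (v : Fin N) (r : ℕ) : Finset (Fin N) :=
  Finset.univ.filter fun w => hdist Edges v w ≤ (r : ℕ∞)

/-- The hypergraph `Edges` contains a Berge cycle. -/
def HasBergeCycle (Edges : Finset (Finset (Fin N))) : Prop :=
  ∃ (ℓ : ℕ) (vs : Fin ℓ → Fin N) (es : Fin ℓ → Finset (Fin N)),
    2 ≤ ℓ ∧ Function.Injective vs ∧ Function.Injective es ∧ (∀ k, es k ∈ Edges) ∧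
      ∀ k : Fin ℓ, vs k ∈ es k ∧ vs (finRotate ℓ k) ∈ es k

/-- `min(d, c)` where `d ∈ ℕ∞` and `c ∈ ℝ` (equal to `c` if `d = ∞`). -/
def truncMin (d : ℕ∞) (c : ℝ) : ℝ :=
  if d = ⊤ then c else min (d.toNat : ℝ) c

/-! ### The diluted mixed p-spin random hypergraph -/

/-- Probability that a given hyperedge is present in the diluted model. -/
def edgeProb (α : ℕ → ℝ) (Δ N : ℕ) (e : Finset (Fin N)) : ℝ :=
  if 2 ≤ e.card ∧ e.card ≤ Δ then α e.card * N / (N.choose e.card) else 0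

/-- The law of the diluted mixed `p`-spin random hypergraph: each hyperedge `e` with
`2 ≤ |e| ≤ Δ` is present independently with probability `α_{|e|} N / C(N,|e|)`. -/
def graphMeasure (α : ℕ → ℝ) (Δ N : ℕ) : Measure (Finset (Fin N) → Bool) :=
  Measure.pi fun e => berBool (edgeProb α Δ N e)

/-- The (random) hyperedge set determined by the indicator `g`. -/
def edgesOf {N : ℕ} (Δ : ℕ) (g : Finset (Fin N) → Bool) : Finset (Finset (Fin N)) :=
  Finset.univ.filter fun e => g e = true ∧ 2 ≤ e.card ∧ e.card ≤ Δ

/-- `λ = Σ_p p(p-1) α_p`. -/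
def lamMix (α : ℕ → ℝ) (Δ : ℕ) : ℝ :=
  ∑ p ∈ Finset.Icc 2 Δ, (p : ℝ) * ((p : ℝ) - 1) * α p

/-- `λ' = Σ_p p(p-1)(p-2) α_p`. -/
def lamMix' (α : ℕ → ℝ) (Δ : ℕ) : ℝ :=
  ∑ p ∈ Finset.Icc 2 Δ, (p : ℝ) * ((p : ℝ) - 1) * ((p : ℝ) - 2) * α p

/-- The exploration (breadth-first search) process `(R_t, I_t, S_t, E_t)` of a hypergraph
started at the vertex `i`. -/
def explore {N : ℕ} (Edges : Finset (Finset (Fin N))) (i : Fin N) :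
    ℕ → Finset (Fin N) × Finset (Fin N) × Finset (Fin N) × Finset (Finset (Fin N))
  | 0 => (∅, {i}, Finset.univ.erase i, ∅)
  | t + 1 =>
      let P := explore Edges i t
      let Enew := Edges.filter fun e => (e ∩ P.2.1).Nonempty ∧ e ∩ P.1 = ∅
      (P.1 ∪ P.2.1, Enew.biUnion fun e => e ∩ P.2.2.1,
        P.2.2.1 \ Enew.biUnion fun e => e ∩ P.2.2.1, Enew)

/-- The set `I_t` of newly explored vertices at step `t`. -/
def Iset {N : ℕ} (Edges : Finset (Finset (Fin N))) (i : Fin N) (t : ℕ) : Finset (Fin N) :=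
  (explore Edges i t).2.1

/-- Disorder-and-graph-averaged two-replica observable under the continuous perturbation
in the diluted model. -/
def dilContExp (α : ℕ → ℝ) (Δ N : ℕ) (ρ : ℕ → ℝ → ℝ) (β t : ℝ)
    (f : (Fin N → Bool) → (Fin N → Bool) → ℝ) : ℝ :=
  ∫ ω : (Finset (Fin N) → Bool) × (Finset (Fin N) → ℝ) × (Finset (Fin N) → ℝ),
    gibbs2 β (ham (edgesOf Δ ω.1) ρ ω.2.1)
      (ham (edgesOf Δ ω.1) ρ (contPerturb t ω.2.1 ω.2.2)) f
    ∂((graphMeasure α Δ N).prod (pairGauss (Finset (Fin N))))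

/-- Disorder-and-graph-averaged two-replica observable under the discrete perturbation
in the diluted model. -/
def dilDiscExp (α : ℕ → ℝ) (Δ N : ℕ) (ρ : ℕ → ℝ → ℝ) (β t : ℝ)
    (f : (Fin N → Bool) → (Fin N → Bool) → ℝ) : ℝ :=
  ∫ ω : (Finset (Fin N) → Bool) ×
      (Finset (Fin N) → ℝ) × (Finset (Fin N) → ℝ) × (Finset (Fin N) → Bool),
    gibbs2 β (ham (edgesOf Δ ω.1) ρ ω.2.1)
      (ham (edgesOf Δ ω.1) ρ (discPerturb ω.2.1 ω.2.2.1 ω.2.2.2)) f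
    ∂((graphMeasure α Δ N).prod (tripleGaussBer (Finset (Fin N)) (Real.exp (-t))))

/-! ### The Lévy model -/

/-- Hamiltonian of the Lévy model: `H(σ) = a_N⁻¹ Σ_{i,j} ρ(J_{ij}) σ_i σ_j`. -/
def levyHam (N : ℕ) (aN : ℝ) (ρ : ℝ → ℝ) (J : Fin N × Fin N → ℝ) (σ : Fin N → Bool) : ℝ :=
  (∑ p : Fin N × Fin N, ρ (J p) * (spin (σ p.1) * spin (σ p.2))) / aN

/-- The normalization `a_N = inf{x > 0 : P(|ρ(J)| > x) ≤ 1/N}`. -/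
def levyAN (ρ : ℝ → ℝ) (N : ℕ) : ℝ :=
  sInf {x : ℝ | 0 < x ∧ ((gaussianReal 0 1) {j | x < |ρ j|}).toReal ≤ 1 / N}

/-- The coupled free energy `F_N(t,λ)` of the Lévy model, with the two systems
perturbed by the Ornstein–Uhlenbeck flow at time `t`. -/
def levyF (N : ℕ) (β aN lam : ℝ) (ρ : ℝ → ℝ) (t : ℝ) : ℝ :=
  (∫ ω : (Fin N × Fin N → ℝ) × (Fin N × Fin N → ℝ) × (Fin N × Fin N → ℝ),
      Real.log (∑ σ : Fin N → Bool, ∑ τ : Fin N → Bool,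
        Real.exp (β * levyHam N aN ρ (fun p => Real.exp (-t / 2) * ω.1 p +
              Real.sqrt (1 - Real.exp (-t)) * ω.2.1 p) σ +
          β * levyHam N aN ρ (fun p => Real.exp (-t / 2) * ω.1 p +
              Real.sqrt (1 - Real.exp (-t)) * ω.2.2 p) τ +
          lam * N * overlap σ τ ^ 2))
    ∂tripleGauss (Fin N × Fin N)) / N

/-- The coupled free energy `F_N(∞,λ)`: the two systems carry independent disorders. -/
def levyFinf (N : ℕ) (β aN lam : ℝ) (ρ : ℝ → ℝ) : ℝ :=
  (∫ ω : (Fin N × Fin N → ℝ) × (Fin N × Fin N → ℝ) × (Fin N × Fin N → ℝ),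
      Real.log (∑ σ : Fin N → Bool, ∑ τ : Fin N → Bool,
        Real.exp (β * levyHam N aN ρ ω.2.1 σ + β * levyHam N aN ρ ω.2.2 τ +
          lam * N * overlap σ τ ^ 2))
    ∂tripleGauss (Fin N × Fin N)) / N

/-- `φ(t) = Σ_r E[L_r(J¹(t)) L_r(J²(t))]` where `J^i(t) = e^{-t/2} J + √(1-e^{-t}) J^i`. -/
def phiFn (k m : ℕ) (L : Fin m → (Fin k → ℝ) → ℝ) (t : ℝ) : ℝ :=
  ∑ r : Fin m, ∫ ω : (Fin k → ℝ) × (Fin k → ℝ) × (Fin k → ℝ),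
    L r (fun l => Real.exp (-t / 2) * ω.1 l + Real.sqrt (1 - Real.exp (-t)) * ω.2.1 l) *
      L r (fun l => Real.exp (-t / 2) * ω.1 l + Real.sqrt (1 - Real.exp (-t)) * ω.2.2 l)
    ∂tripleGauss (Fin k)

/-- The graph on the vertex set in which two vertices are adjacent when they share a hyperedge
of `T`. -/
def primalGraph (T : Finset (Finset (Fin N))) : SimpleGraph (Fin N) where
  Adj v w := v ≠ w ∧ ∃ e ∈ T, v ∈ e ∧ w ∈ e
  symm := ⟨fun _ _ h => ⟨h.1.symm, h.2.imp fun _ he => ⟨he.1, he.2.2, he.2.1⟩⟩⟩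
  loopless := ⟨fun _ h => h.1 rfl⟩

lemma primalGraph_reachable_of_mem {T : Finset (Finset (Fin N))} {e : Finset (Fin N)}
    (he : e ∈ T) {v w : Fin N} (hv : v ∈ e) (hw : w ∈ e) : (primalGraph T).Reachable v w := by
  by_cases h : v = w
  · exact h ▸ SimpleGraph.Reachable.refl _
  · exact SimpleGraph.Adj.reachable (G := primalGraph T) ⟨h, e, he, hv, hw⟩

lemma primalGraph_dist_le_of_mem {T : Finset (Finset (Fin N))} {e : Finset (Fin N)}
    (he : e ∈ T) {v w : Fin N} (hv : v ∈ e) (hw : w ∈ e) : (primalGraph T).dist v w ≤ 1 := by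
  by_cases h : v = w
  · simp [h]
  · exact (SimpleGraph.dist_eq_one_iff_adj.2 (show (primalGraph T).Adj v w from
      ⟨h, e, he, hv, hw⟩)).le

/-- Two vertices joined inside a set `T` of hyperedges are at hypergraph distance at most `|T|`. -/
lemma hdist_le_card_of_reachable {Edges T : Finset (Finset (Fin N))} (hT : T ⊆ Edges)
    {i j : Fin N} (h : (primalGraph T).Reachable i j) : hdist Edges i j ≤ (T.card : ℕ∞) := by
  obtain ⟨p, hp⟩ := h.exists_walk_length_eq_dist
  set ℓ := p.length
  have hr : ∀ k, (primalGraph T).Reachable i (p.getVert k) := fun k => ⟨p.take k⟩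
  have hd : ∀ k ≤ ℓ, (primalGraph T).dist i (p.getVert k) = k := by
    intro k hk
    have h1 : (primalGraph T).dist i (p.getVert k) ≤ k :=
      (SimpleGraph.dist_le (p.take k)).trans (by simp [SimpleGraph.Walk.take_length])
    have h2 : (primalGraph T).dist (p.getVert k) j ≤ ℓ - k :=
      (SimpleGraph.dist_le (p.drop k)).trans (by simp [SimpleGraph.Walk.drop_length, ℓ])
    have h3 := (hr k).dist_triangle_left j
    omega
  have hadj : ∀ k : Fin ℓ, ∃ e ∈ T, p.getVert k ∈ e ∧ p.getVert (k + 1) ∈ e :=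
    fun k => (p.adj_getVert_succ k.2).2
  choose es hes hv hv' using hadj
  have hes_inj : Function.Injective es := by
    have key : ∀ k l : Fin ℓ, k < l → es k ≠ es l := by
      intro k l hkl hE
      have h1 := primalGraph_dist_le_of_mem (hes k) (hv k) (hE ▸ hv' l)
      have h2 := (hr k).dist_triangle_left (p.getVert (l + 1))
      rw [hd _ k.2.le, hd (l + 1) l.2] at h2
      have : (k : ℕ) < l := hkl
      omega
    intro k l hE
    by_contra hne
    rcases lt_or_gt_of_ne hne with h | h
    · exact key _ _ h hE
    · exact key _ _ h hE.symm
  have hcard : ℓ ≤ T.card := by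
    have := Finset.card_le_card_of_injOn (s := (univ : Finset (Fin ℓ))) (t := T) es
      (fun k _ => hes k) hes_inj.injOn
    simpa using this
  have hpath : IsBergePath Edges ℓ (fun k => p.getVert k) es i j := by
    refine ⟨?_, hes_inj, fun k => hT (hes k), ?_, ?_, ?_⟩
    · intro k l hkl
      have h1 := hd k (Nat.lt_succ_iff.1 k.2)
      have h2 := hd l (Nat.lt_succ_iff.1 l.2)
      have : p.getVert k = p.getVert l := hkl
      rw [this] at h1
      exact Fin.ext (h1.symm.trans h2)
    · simp
    · simp [ℓ]
    · intro k
      exact ⟨by simpa using hv k, by simpa using hv' k⟩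
  have hle : hdist Edges i j ≤ (ℓ : ℕ∞) := sInf_le ⟨ℓ, _, es, hpath, rfl⟩
  exact hle.trans (Nat.cast_le.2 hcard)

lemma spin_eq (b : Bool) : spin b = 1 ∨ spin b = -1 := by cases b <;> simp [spin]

lemma spin_beq (a b : Bool) : spin (a == b) = spin a * spin b := by
  cases a <;> cases b <;> simp [spin]

lemma abs_spin (b : Bool) : |spin b| = 1 := by cases b <;> simp [spin]

lemma sigEdge_eq (c : Fin N → Bool) (e : Finset (Fin N)) :
    sigEdge c e = 1 ∨ sigEdge c e = -1 := by
  unfold sigEdge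
  refine Finset.prod_induction _ (fun x : ℝ => x = 1 ∨ x = -1) ?_ (Or.inl rfl)
    (fun v _ => spin_eq _)
  rintro a b (rfl | rfl) (rfl | rfl) <;> simp

/-- The two-point correlation function `⟨σ_i σ_j⟩` as a function of the disorder. -/
def twoPoint (Edges : Finset (Finset (Fin N))) (ρ : ℕ → ℝ → ℝ) (β : ℝ) (i j : Fin N)
    (J : Finset (Fin N) → ℝ) : ℝ :=
  gibbs β (ham Edges ρ J) fun σ => spin (σ i) * spin (σ j)

lemma abs_gibbs_le_one (β : ℝ) (H f : (Fin N → Bool) → ℝ) (hf : ∀ σ, |f σ| ≤ 1) :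
    |gibbs β H f| ≤ 1 := by
  have hZ : 0 < ∑ σ : Fin N → Bool, Real.exp (β * H σ) :=
    Finset.sum_pos (fun _ _ => Real.exp_pos _) univ_nonempty
  rw [gibbs, abs_div, abs_of_pos hZ, div_le_one hZ]
  refine (Finset.abs_sum_le_sum_abs _ _).trans (Finset.sum_le_sum fun σ _ => ?_)
  rw [abs_mul, abs_of_pos (Real.exp_pos _)]
  exact mul_le_of_le_one_left (Real.exp_pos _).le (hf σ)

lemma abs_twoPoint_le_one (Edges : Finset (Finset (Fin N))) (ρ : ℕ → ℝ → ℝ) (β : ℝ)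
    (i j : Fin N) (J : Finset (Fin N) → ℝ) : |twoPoint Edges ρ β i j J| ≤ 1 :=
  abs_gibbs_le_one _ _ _ fun σ => by simp [abs_mul, abs_spin]

lemma measurable_twoPoint (Edges : Finset (Finset (Fin N))) {ρ : ℕ → ℝ → ℝ}
    (hρ : ∀ p, Measurable (ρ p)) (β : ℝ) (i j : Fin N) :
    Measurable (twoPoint Edges ρ β i j) := by
  unfold twoPoint gibbs ham
  fun_prop

/-- Gauge covariance: flipping the spins along `c` and the couplings accordingly multiplies the
two-point function by `c_i c_j`. -/
lemma twoPoint_gauge (Edges : Finset (Finset (Fin N))) {ρ : ℕ → ℝ → ℝ}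
    (hodd : ∀ p x, ρ p (-x) = - ρ p x) (β : ℝ) (i j : Fin N) (c : Fin N → Bool)
    (ε : Finset (Fin N) → ℝ) (hε : ∀ e ∈ Edges, ε e = sigEdge c e) (J : Finset (Fin N) → ℝ) :
    twoPoint Edges ρ β i j (fun e => ε e * J e)
      = spin (c i) * spin (c j) * twoPoint Edges ρ β i j J := by
  have hsig : ∀ (σ : Fin N → Bool) e, sigEdge (fun v => c v == σ v) e
      = sigEdge c e * sigEdge σ e := fun σ e => by
    simp only [sigEdge, ← Finset.prod_mul_distrib, spin_beq]
  have hham : ∀ σ, ham Edges ρ (fun e => ε e * J e) (fun v => c v == σ v)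
      = ham Edges ρ J σ := by
    intro σ
    refine Finset.sum_congr rfl fun e he => ?_
    simp only [hsig, hε e he]
    rcases sigEdge_eq c e with h | h <;> simp [h, hodd]
  have hbeq : ∀ a b : Bool, (a == (a == b)) = b := by decide
  let Φ : (Fin N → Bool) ≃ (Fin N → Bool) :=
    { toFun := fun σ v => c v == σ v
      invFun := fun σ v => c v == σ v
      left_inv := fun σ => funext fun v => hbeq (c v) (σ v)
      right_inv := fun σ => funext fun v => hbeq (c v) (σ v) }
  unfold twoPoint gibbs
  rw [← Φ.sum_comp, ← Φ.sum_comp (fun σ => Real.exp (β * ham Edges ρ _ σ)), ← mul_div_assoc,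
    Finset.mul_sum]
  have hΦ : ∀ σ, Φ σ = fun v => c v == σ v := fun _ => rfl
  simp only [hΦ, hham, spin_beq]
  congr 1
  refine Finset.sum_congr rfl fun σ _ => ?_
  ring

/-- If fewer couplings than the distance between `i` and `j` are frozen, the signs of the other
couplings can be flipped so as to change the sign of `⟨σ_i σ_j⟩`. -/
lemma exists_sign_twoPoint_neg {Edges : Finset (Finset (Fin N))} {ρ : ℕ → ℝ → ℝ}
    (heven : ∀ e ∈ Edges, Even e.card) (hodd : ∀ p x, ρ p (-x) = - ρ p x) (β : ℝ)
    {i j : Fin N} {d : ℕ} (hd : (d : ℕ∞) ≤ hdist Edges i j) (S : Finset (Finset (Fin N)))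
    (hS : S.card < d) :
    ∃ ε : Finset (Fin N) → ℝ, (∀ e, ε e = 1 ∨ ε e = -1) ∧ (∀ e ∈ S, ε e = 1) ∧
      ∀ J, twoPoint Edges ρ β i j (fun e => ε e * J e) = - twoPoint Edges ρ β i j J := by
  classical
  set T := S ∩ Edges
  have hnr : ¬ (primalGraph T).Reachable i j := by
    intro h
    have h1 := hd.trans (hdist_le_card_of_reachable inter_subset_right h)
    have h2 : T.card ≤ S.card := Finset.card_le_card inter_subset_left
    have h3 : d ≤ T.card := by exact_mod_cast h1
    omega
  let c : Fin N → Bool := fun v => !decide ((primalGraph T).Reachable i v)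
  refine ⟨fun e => if e ∈ Edges then sigEdge c e else 1, ?_, ?_, fun J => ?_⟩
  · intro e
    dsimp only
    split_ifs
    · exact sigEdge_eq c e
    · exact Or.inl rfl
  · intro e heS
    dsimp only
    split_ifs with heE
    · have heT : e ∈ T := mem_inter.2 ⟨heS, heE⟩
      by_cases hx : ∃ v ∈ e, (primalGraph T).Reachable i v
      · obtain ⟨v, hv, hiv⟩ := hx
        have : sigEdge c e = ∏ _v ∈ e, (-1 : ℝ) := Finset.prod_congr rfl fun w hw => by
          have := hiv.trans (primalGraph_reachable_of_mem heT hv hw)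
          simp [c, spin, this]
        rw [this, Finset.prod_const, (heven e heE).neg_one_pow]
      · push Not at hx
        exact Finset.prod_eq_one fun w hw => by simp [c, spin, hx w hw]
    · rfl
  · rw [twoPoint_gauge Edges hodd β i j c _ (fun e he => by simp [he]) J]
    simp [c, spin, hnr]

/-- A function with `g(t)² ≤ g(2t)` that decays like `C e^{-Td}` at infinity is bounded by
`e^{-td}` at every positive time. -/
lemma le_exp_neg_of_sq_le {g : ℝ → ℝ} {C T₀ d : ℝ} (hsq : ∀ t, 0 < t → g t ^ 2 ≤ g (2 * t))
    (hC : ∀ T, T₀ ≤ T → g T ≤ C * Real.exp (-T * d)) {t : ℝ} (ht : 0 < t) :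
    g t ≤ Real.exp (-t * d) := by
  by_contra! hlt
  set a := Real.exp (-t * d) with ha
  have hapos : 0 < a := Real.exp_pos _
  have hr : 1 < g t / a := (one_lt_div hapos).2 hlt
  have hgpos : 0 < g t := hapos.trans hlt
  have hpow : ∀ k : ℕ, g t ^ (2 ^ k) ≤ g (2 ^ k * t) := by
    intro k
    induction k with
    | zero => simp
    | succ k ih =>
      calc g t ^ (2 ^ (k + 1)) = (g t ^ (2 ^ k)) ^ 2 := by rw [pow_succ 2 k, pow_mul]
        _ ≤ g (2 ^ k * t) ^ 2 := pow_le_pow_left₀ (by positivity) ih 2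
        _ ≤ g (2 * (2 ^ k * t)) := hsq _ (by positivity)
        _ = g (2 ^ (k + 1) * t) := by rw [pow_succ]; ring_nf
  have hbound : ∀ k : ℕ, T₀ ≤ 2 ^ k * t → (g t / a) ^ (2 ^ k) ≤ C := by
    intro k hk
    have h1 := (hpow k).trans (hC _ hk)
    have h2 : Real.exp (-(2 ^ k * t) * d) = a ^ (2 ^ k) := by
      rw [ha, ← Real.exp_nat_mul]
      congr 1
      push_cast
      ring
    rwa [h2, ← div_le_iff₀ (by positivity), ← div_pow] at h1
  obtain ⟨n, hn⟩ := pow_unbounded_of_one_lt C hr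
  obtain ⟨m, hm⟩ := exists_nat_ge (T₀ / t)
  set k := max n m
  have hk2 : k < 2 ^ k := Nat.lt_two_pow_self
  have h3 : T₀ ≤ 2 ^ k * t := by
    rw [← div_le_iff₀ ht]
    have : (m : ℝ) ≤ (2 ^ k : ℕ) := by
      exact_mod_cast (le_max_right n m).trans hk2.le
    push_cast at this
    linarith
  have h4 : (g t / a) ^ n ≤ (g t / a) ^ (2 ^ k) :=
    pow_le_pow_right₀ hr.le ((le_max_left n m).trans hk2.le)
  linarith [hbound k h3]

lemma integrable_of_abs_le_one {X : Type*} [MeasurableSpace X] {μ : Measure X}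
    [IsFiniteMeasure μ] {f : X → ℝ} (hf : Measurable f) (hb : ∀ x, |f x| ≤ 1) :
    Integrable f μ :=
  .of_bound hf.aestronglyMeasurable 1 (.of_forall hb)

lemma abs_integral_le_one {X : Type*} [MeasurableSpace X] {μ : Measure X}
    [IsProbabilityMeasure μ] {f : X → ℝ} (hb : ∀ x, |f x| ≤ 1) : |∫ x, f x ∂μ| ≤ 1 := by
  simpa using norm_integral_le_of_norm_le_const (μ := μ) (f := f) (.of_forall hb)

/-- `⟨φ, Pφ⟩² ≤ ⟨φ, P²φ⟩` for a symmetric operator `P` and `|φ| ≤ 1`. -/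
lemma sq_integral_mul_le {X : Type*} [MeasurableSpace X] {μ : Measure X}
    [IsProbabilityMeasure μ] {φ ψ χ : X → ℝ} (hφ : Measurable φ) (hψ : Measurable ψ)
    (hφ1 : ∀ x, |φ x| ≤ 1) (hψ1 : ∀ x, |ψ x| ≤ 1)
    (hsymm : ∫ x, φ x * χ x ∂μ = ∫ x, ψ x * ψ x ∂μ) :
    (∫ x, φ x * ψ x ∂μ) ^ 2 ≤ ∫ x, φ x * χ x ∂μ := by
  have hb : ∀ x, |φ x * ψ x| ≤ 1 := fun x => by
    rw [abs_mul]; exact mul_le_one₀ (hφ1 x) (abs_nonneg _) (hψ1 x)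
  have hint : MemLp (fun x => φ x * ψ x) 2 μ :=
    MemLp.of_bound (hφ.mul hψ).aestronglyMeasurable 1 (.of_forall hb)
  have hv := variance_nonneg (fun x => φ x * ψ x) μ
  rw [variance_eq_sub hint] at hv
  rw [hsymm]
  refine (sub_nonneg.1 hv).trans (integral_mono ?_ ?_ fun x => ?_)
  · exact hint.integrable_sq
  · refine integrable_of_abs_le_one (hψ.mul hψ) fun x => ?_
    rw [abs_mul]; exact mul_le_one₀ (hψ1 x) (abs_nonneg _) (hψ1 x)
  · have h1 : φ x ^ 2 ≤ 1 := (sq_le_one_iff_abs_le_one _).2 (hφ1 x)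
    simp only [Pi.pow_apply]
    nlinarith [mul_le_mul_of_nonneg_right h1 (sq_nonneg (ψ x))]

lemma map_sign_mul_gaussianPi {ι : Type*} [Fintype ι] (ε : ι → ℝ)
    (hε : ∀ e, ε e = 1 ∨ ε e = -1) :
    (gaussianPi ι).map (fun x e => ε e * x e) = gaussianPi ι := by
  unfold gaussianPi
  rw [Measure.pi_map_pi (f := fun e x => ε e * x) (fun e => by fun_prop)]
  congr 1
  funext e
  rw [gaussianReal_map_const_mul]
  rcases hε e with h | h <;> simp [h]

/-- The two-point function is orthogonal to every function of fewer couplings than the distance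
between the two points. -/
lemma integral_twoPoint_mul_eq_zero {Edges : Finset (Finset (Fin N))} {ρ : ℕ → ℝ → ℝ}
    (hρ : ∀ p, Measurable (ρ p)) (heven : ∀ e ∈ Edges, Even e.card)
    (hodd : ∀ p x, ρ p (-x) = - ρ p x) (β : ℝ)
    {i j : Fin N} {d : ℕ} (hd : (d : ℕ∞) ≤ hdist Edges i j) (S : Finset (Finset (Fin N)))
    (hS : S.card < d) {F : (Finset (Fin N) → ℝ) → ℝ} (hF : Measurable F)
    (hFS : ∀ x y, (∀ e ∈ S, x e = y e) → F x = F y) :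
    ∫ x, twoPoint Edges ρ β i j x * F x ∂gaussianPi (Finset (Fin N)) = 0 := by
  obtain ⟨ε, hε, hεS, hneg⟩ := exists_sign_twoPoint_neg heven hodd β hd S hS
  have hmeas : Measurable fun (x : Finset (Fin N) → ℝ) e => ε e * x e := by fun_prop
  have h : ∫ x, twoPoint Edges ρ β i j x * F x ∂gaussianPi (Finset (Fin N))
      = - ∫ x, twoPoint Edges ρ β i j x * F x ∂gaussianPi (Finset (Fin N)) := by
    conv_lhs => rw [← map_sign_mul_gaussianPi ε hε]
    have hm : Measurable fun x => twoPoint Edges ρ β i j x * F x :=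
      (measurable_twoPoint Edges hρ β i j).mul hF
    rw [integral_map hmeas.aemeasurable hm.aestronglyMeasurable, ← integral_neg]
    refine integral_congr_ae (.of_forall fun x => ?_)
    dsimp only
    rw [hneg, hFS _ x fun e he => by simp [hεS e he]]
    ring
  linarith

lemma isProbabilityMeasure_berBool {p : ℝ} (h0 : 0 ≤ p) (h1 : p ≤ 1) :
    IsProbabilityMeasure (berBool p) := by
  constructor
  simp only [berBool, Measure.coe_add, Pi.add_apply, Measure.smul_apply, smul_eq_mul,
    measure_univ, mul_one]
  rw [← ENNReal.ofReal_add h0 (by linarith)]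
  simp

lemma berBool_real_true {p : ℝ} (h0 : 0 ≤ p) : (berBool p).real {true} = p := by
  simp [berBool, Measure.real, h0]

lemma map_and_berBool {p : ℝ} (h0 : 0 ≤ p) (h1 : p ≤ 1) :
    ((berBool p).prod (berBool p)).map (fun b => b.1 && b.2) = berBool (p * p) := by
  have hm : Measurable fun b : Bool × Bool => b.1 && b.2 := measurable_of_finite _
  have := isProbabilityMeasure_berBool h0 h1
  have := isProbabilityMeasure_berBool (mul_nonneg h0 h0) (mul_le_one₀ h1 h0 h1)
  have := Measure.isProbabilityMeasure_map (μ := (berBool p).prod (berBool p)) hm.aemeasurable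
  have htrue : (((berBool p).prod (berBool p)).map (fun b => b.1 && b.2)) {true}
      = berBool (p * p) {true} := by
    rw [Measure.map_apply hm (measurableSet_singleton _)]
    have : (fun b : Bool × Bool => b.1 && b.2) ⁻¹' {true} = {true} ×ˢ {true} := by
      ext ⟨a, b⟩
      simp
    rw [this, Measure.prod_prod]
    simp [berBool, ENNReal.ofReal_mul h0]
  refine Measure.ext_of_singleton fun b => ?_
  cases b with
  | true => exact htrue
  | false =>
    have : ({false} : Set Bool) = {true}ᶜ := by ext b; cases b <;> simp
    rw [this, prob_compl_eq_one_sub (measurableSet_singleton _),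
      prob_compl_eq_one_sub (measurableSet_singleton _), htrue]

/-- The law of an i.i.d. family of Bernoulli variables. -/
def berPi (ι : Type*) [Fintype ι] (p : ℝ) : Measure (ι → Bool) :=
  Measure.pi fun _ => berBool p

instance (ι : Type*) [Fintype ι] (p : ℝ) : IsFiniteMeasure (berPi ι p) := by
  unfold berPi; infer_instance

lemma isProbabilityMeasure_berPi {ι : Type*} [Fintype ι] {p : ℝ} (h0 : 0 ≤ p) (h1 : p ≤ 1) :
    IsProbabilityMeasure (berPi ι p) := by
  have := isProbabilityMeasure_berBool h0 h1
  unfold berPi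
  infer_instance

lemma measurable_discPerturb {ι : Type*} (B : ι → Bool) :
    Measurable fun z : (ι → ℝ) × (ι → ℝ) => discPerturb z.1 z.2 B := by
  unfold discPerturb
  refine measurable_pi_lambda _ fun e => ?_
  cases B e <;> simp <;> fun_prop

section

variable {ι : Type*} [Fintype ι]

lemma map_pi_prod_pi {α β δ : Type*} [MeasurableSpace α] [MeasurableSpace β] [MeasurableSpace δ]
    (μ : Measure α) (ν : Measure β) [SigmaFinite μ] [SigmaFinite ν] {f : α × β → δ}
    (hf : Measurable f) (κ : Measure δ) [SigmaFinite κ] (h : (μ.prod ν).map f = κ) :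
    ((Measure.pi fun _ : ι => μ).prod (Measure.pi fun _ : ι => ν)).map
      (fun z e => f (z.1 e, z.2 e)) = Measure.pi fun _ : ι => κ := by
  have hE := (measurePreserving_arrowProdEquivProdArrow α β ι (fun _ => μ) (fun _ => ν)).map_eq
  subst h
  rw [← hE, Measure.map_map (by fun_prop) (MeasurableEquiv.measurable _)]
  exact Measure.pi_map_pi (μ := fun _ : ι => μ.prod ν) (f := fun _ => f)
    (fun _ => hf.aemeasurable)

lemma map_and_berPi {p : ℝ} (h0 : 0 ≤ p) (h1 : p ≤ 1) :
    ((berPi ι p).prod (berPi ι p)).map (fun B e => B.1 e && B.2 e) = berPi ι (p * p) :=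
  map_pi_prod_pi _ _ (measurable_of_finite _) _ (map_and_berBool h0 h1)

/-- Swapping the coordinates outside `B` of two independent Gaussian vectors preserves their
joint law. -/
lemma map_swap_gaussianPi (B : ι → Bool) :
    ((gaussianPi ι).prod (gaussianPi ι)).map
      (fun z => (discPerturb z.1 z.2 B, discPerturb z.2 z.1 B))
      = (gaussianPi ι).prod (gaussianPi ι) := by
  have hE := (measurePreserving_arrowProdEquivProdArrow ℝ ℝ ι
    (fun _ => gaussianReal 0 1) (fun _ => gaussianReal 0 1)).map_eq
  have hdisc : Measurable fun z : (ι → ℝ) × (ι → ℝ) =>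
      (discPerturb z.1 z.2 B, discPerturb z.2 z.1 B) :=
    (measurable_discPerturb B).prodMk ((measurable_discPerturb B).comp measurable_swap)
  let T : (e : ι) → ℝ × ℝ → ℝ × ℝ := fun e z => if B e then z else z.swap
  have hT : ∀ e, Measurable (T e) := fun e => by
    change Measurable fun z : ℝ × ℝ => if B e then z else z.swap
    cases B e <;> simp <;> fun_prop
  have hTpi : Measurable fun (z : ι → ℝ × ℝ) e => T e (z e) :=
    measurable_pi_lambda _ fun e => (hT e).comp (measurable_pi_apply e)
  have hpi : (Measure.pi fun _ : ι => (gaussianReal 0 1).prod (gaussianReal 0 1)).map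
      (fun z e => T e (z e)) = Measure.pi fun _ : ι => (gaussianReal 0 1).prod (gaussianReal 0 1) := by
    rw [Measure.pi_map_pi (fun e => (hT e).aemeasurable)]
    congr 1
    funext e
    change Measure.map (fun z : ℝ × ℝ => if B e then z else z.swap) _ = _
    cases B e
    · simpa using Measure.prod_swap
    · simp
  have hcomm : (fun z : (ι → ℝ) × (ι → ℝ) => (discPerturb z.1 z.2 B, discPerturb z.2 z.1 B)) ∘
      MeasurableEquiv.arrowProdEquivProdArrow ℝ ℝ ι
      = MeasurableEquiv.arrowProdEquivProdArrow ℝ ℝ ι ∘ fun z e => T e (z e) := by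
    funext z
    refine Prod.ext ?_ ?_ <;> funext e <;>
      simp only [Function.comp, discPerturb, T, MeasurableEquiv.arrowProdEquivProdArrow,
        MeasurableEquiv.coe_mk, Equiv.arrowProdEquivProdArrow, Equiv.coe_fn_mk] <;>
      split_ifs <;> rfl
  unfold gaussianPi
  rw [← hE, Measure.map_map hdisc (MeasurableEquiv.measurable _), hcomm,
    ← Measure.map_map (MeasurableEquiv.measurable _) hTpi, hpi]

/-- Resampling the couplings outside `B`. -/
def resample (B : ι → Bool) (φ : (ι → ℝ) → ℝ) (x : ι → ℝ) : ℝ :=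
  ∫ y, φ (discPerturb x y B) ∂gaussianPi ι

lemma measurable_resample (B : ι → Bool) {φ : (ι → ℝ) → ℝ} (hφ : Measurable φ) :
    Measurable (resample B φ) :=
  (StronglyMeasurable.integral_prod_right'
    (hφ.comp (measurable_discPerturb B)).stronglyMeasurable).measurable

lemma abs_resample_le_one (B : ι → Bool) {φ : (ι → ℝ) → ℝ} (h1 : ∀ x, |φ x| ≤ 1) (x : ι → ℝ) :
    |resample B φ x| ≤ 1 :=
  abs_integral_le_one fun _ => h1 _

lemma abs_mul_le_one' {a b : ℝ} (ha : |a| ≤ 1) (hb : |b| ≤ 1) : |a * b| ≤ 1 := by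
  rw [abs_mul]; exact mul_le_one₀ ha (abs_nonneg _) hb

lemma integral_mul_resample (B : ι → Bool) {φ ψ : (ι → ℝ) → ℝ} (hφ : Measurable φ)
    (hψ : Measurable ψ) (hφ1 : ∀ x, |φ x| ≤ 1) (hψ1 : ∀ x, |ψ x| ≤ 1) :
    ∫ x, φ x * resample B ψ x ∂gaussianPi ι = ∫ x, ψ x * resample B φ x ∂gaussianPi ι := by
  have key : ∀ {φ ψ : (ι → ℝ) → ℝ}, Measurable φ → Measurable ψ → (∀ x, |φ x| ≤ 1) →
      (∀ x, |ψ x| ≤ 1) → ∫ x, φ x * resample B ψ x ∂gaussianPi ι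
        = ∫ z, φ z.1 * ψ (discPerturb z.1 z.2 B) ∂(gaussianPi ι).prod (gaussianPi ι) := by
    intro φ ψ hφ hψ hφ1 hψ1
    rw [integral_prod]
    · simp_rw [integral_const_mul]
      rfl
    · exact integrable_of_abs_le_one ((hφ.comp measurable_fst).mul
        (hψ.comp (measurable_discPerturb B))) fun z => abs_mul_le_one' (hφ1 _) (hψ1 _)
  rw [key hφ hψ hφ1 hψ1, key hψ hφ hψ1 hφ1]
  have hm : Measurable fun z : (ι → ℝ) × (ι → ℝ) => φ z.1 * ψ (discPerturb z.1 z.2 B) :=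
    (hφ.comp measurable_fst).mul (hψ.comp (measurable_discPerturb B))
  have hT : Measurable fun z : (ι → ℝ) × (ι → ℝ) =>
      (discPerturb z.1 z.2 B, discPerturb z.2 z.1 B) :=
    (measurable_discPerturb B).prodMk ((measurable_discPerturb B).comp measurable_swap)
  conv_lhs => rw [← map_swap_gaussianPi B]
  rw [integral_map hT.aemeasurable hm.aestronglyMeasurable]
  refine integral_congr_ae (.of_forall fun z => ?_)
  have : discPerturb (discPerturb z.1 z.2 B) (discPerturb z.2 z.1 B) B = z.1 := by
    funext e
    simp only [discPerturb]
    split_ifs <;> rfl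
  simp only [this]
  ring

lemma resample_resample (B C : ι → Bool) {φ : (ι → ℝ) → ℝ} (hφ : Measurable φ)
    (hφ1 : ∀ x, |φ x| ≤ 1) (x : ι → ℝ) :
    resample B (resample C φ) x = resample (fun e => B e && C e) φ x := by
  have hc : ∀ y y' : ι → ℝ, discPerturb (discPerturb x y B) y' C
      = discPerturb x (discPerturb y y' C) (fun e => B e && C e) := by
    intro y y'
    funext e
    simp only [discPerturb]
    by_cases hB : B e = true <;> by_cases hC : C e = true <;> simp [hB, hC]
  have hdx : Measurable fun y => discPerturb x y (fun e => B e && C e) :=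
    (measurable_discPerturb _).comp measurable_prodMk_left
  have hT : Measurable fun z : (ι → ℝ) × (ι → ℝ) =>
      (discPerturb z.1 z.2 C, discPerturb z.2 z.1 C) :=
    (measurable_discPerturb C).prodMk ((measurable_discPerturb C).comp measurable_swap)
  have hm : Measurable fun z : (ι → ℝ) × (ι → ℝ) =>
      φ (discPerturb x z.1 (fun e => B e && C e)) := hφ.comp (hdx.comp measurable_fst)
  unfold resample
  simp_rw [hc]
  rw [← integral_prod (fun z : (ι → ℝ) × (ι → ℝ) =>
      φ (discPerturb x (discPerturb z.1 z.2 C) (fun e => B e && C e)))]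
  · rw [← integral_map (φ := fun z : (ι → ℝ) × (ι → ℝ) =>
      (discPerturb z.1 z.2 C, discPerturb z.2 z.1 C))
      (f := fun z => φ (discPerturb x z.1 (fun e => B e && C e)))
      hT.aemeasurable hm.aestronglyMeasurable, map_swap_gaussianPi, integral_prod]
    · simp
    · exact integrable_of_abs_le_one hm fun _ => hφ1 _
  · exact integrable_of_abs_le_one
      (hφ.comp (hdx.comp (measurable_discPerturb C))) fun _ => hφ1 _

end

lemma measurable_discPerturb_joint {ι : Type*} :
    Measurable fun ω : (ι → ℝ) × (ι → ℝ) × (ι → Bool) => discPerturb ω.1 ω.2.1 ω.2.2 := by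
  unfold discPerturb
  refine measurable_pi_lambda _ fun e => Measurable.ite ?_ (by fun_prop) (by fun_prop)
  exact (measurableSet_singleton true).preimage
    (show Measurable fun ω : (ι → ℝ) × (ι → ℝ) × (ι → Bool) => ω.2.2 e by fun_prop)

section

variable {ι : Type*} [Fintype ι]

lemma integrable_mul_resample (B : ι → Bool) {φ ψ : (ι → ℝ) → ℝ} (hφ : Measurable φ)
    (hψ : Measurable ψ) (hφ1 : ∀ x, |φ x| ≤ 1) (hψ1 : ∀ x, |ψ x| ≤ 1) :
    Integrable (fun x => φ x * resample B ψ x) (gaussianPi ι) :=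
  integrable_of_abs_le_one (hφ.mul (measurable_resample B hψ)) fun x =>
    abs_mul_le_one' (hφ1 x) (abs_resample_le_one B hψ1 x)

lemma berPi_real_le {p : ℝ} (h0 : 0 ≤ p) (h1 : p ≤ 1) (B : ι → Bool) {d : ℕ}
    (hd : d ≤ (univ.filter fun e => B e = true).card) : (berPi ι p).real {B} ≤ p ^ d := by
  have := isProbabilityMeasure_berBool h0 h1
  have h : (berPi ι p).real {B} = ∏ e, (berBool p).real {B e} := by
    rw [Measure.real, berPi, ← Set.univ_pi_singleton, Measure.pi_pi, ENNReal.toReal_prod]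
    rfl
  rw [h]
  calc ∏ e, (berBool p).real {B e} ≤ ∏ e, if B e = true then p else 1 := by
        refine Finset.prod_le_prod (fun _ _ => measureReal_nonneg) fun e _ => ?_
        split_ifs with hB
        · rw [hB, berBool_real_true h0]
        · exact measureReal_le_one
    _ = p ^ (univ.filter fun e => B e = true).card := by
        rw [Finset.prod_ite]; simp
    _ ≤ p ^ d := pow_le_pow_of_le_one h0 h1 hd

/-- The correlation `E[φ(J) φ(J(t))]` under the discrete perturbation with `p = e^{-t}`. -/
def discCorr (p : ℝ) (φ : (ι → ℝ) → ℝ) : ℝ :=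
  ∫ ω : (ι → ℝ) × (ι → ℝ) × (ι → Bool), φ ω.1 * φ (discPerturb ω.1 ω.2.1 ω.2.2)
    ∂tripleGaussBer ι p

variable [DecidableEq ι]

/-- The discrete noise operator. -/
def discOp (p : ℝ) (φ : (ι → ℝ) → ℝ) (x : ι → ℝ) : ℝ :=
  ∑ B : ι → Bool, (berPi ι p).real {B} * resample B φ x

lemma measurable_discOp (p : ℝ) {φ : (ι → ℝ) → ℝ} (hφ : Measurable φ) :
    Measurable (discOp p φ) := by
  unfold discOp
  exact Finset.measurable_fun_sum _ fun B _ => (measurable_resample B hφ).const_mul _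

lemma sum_berPi_real {p : ℝ} (h0 : 0 ≤ p) (h1 : p ≤ 1) :
    ∑ B : ι → Bool, (berPi ι p).real {B} = 1 := by
  have := isProbabilityMeasure_berPi (ι := ι) h0 h1
  simp

lemma abs_discOp_le_one {p : ℝ} (h0 : 0 ≤ p) (h1 : p ≤ 1) {φ : (ι → ℝ) → ℝ}
    (hφ1 : ∀ x, |φ x| ≤ 1) (x : ι → ℝ) : |discOp p φ x| ≤ 1 := by
  refine (Finset.abs_sum_le_sum_abs _ _).trans ?_
  rw [← sum_berPi_real (ι := ι) h0 h1]
  refine Finset.sum_le_sum fun B _ => ?_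
  rw [abs_mul, abs_of_nonneg measureReal_nonneg]
  exact mul_le_of_le_one_right measureReal_nonneg (abs_resample_le_one B hφ1 x)

lemma integral_mul_discOp (p : ℝ) {φ ψ : (ι → ℝ) → ℝ} (hφ : Measurable φ)
    (hψ : Measurable ψ) (hφ1 : ∀ x, |φ x| ≤ 1) (hψ1 : ∀ x, |ψ x| ≤ 1) :
    ∫ x, φ x * discOp p ψ x ∂gaussianPi ι
      = ∑ B : ι → Bool, (berPi ι p).real {B} * ∫ x, φ x * resample B ψ x ∂gaussianPi ι := by
  simp_rw [discOp, Finset.mul_sum, mul_left_comm (φ _)]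
  rw [integral_finsetSum _ fun B _ => (integrable_mul_resample B hφ hψ hφ1 hψ1).const_mul _]
  simp_rw [integral_const_mul]

lemma discCorr_eq (p : ℝ) {φ : (ι → ℝ) → ℝ} (hφ : Measurable φ)
    (hφ1 : ∀ x, |φ x| ≤ 1) :
    discCorr p φ = ∫ x, φ x * discOp p φ x ∂gaussianPi ι := by
  have hm : Measurable fun ω : (ι → ℝ) × (ι → ℝ) × (ι → Bool) =>
      φ (discPerturb ω.1 ω.2.1 ω.2.2) := hφ.comp measurable_discPerturb_joint
  unfold discCorr tripleGaussBer
  change ∫ ω, φ ω.1 * φ (discPerturb ω.1 ω.2.1 ω.2.2)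
    ∂(gaussianPi ι).prod ((gaussianPi ι).prod (berPi ι p)) = _
  rw [integral_prod]
  · refine integral_congr_ae (.of_forall fun x => ?_)
    dsimp only
    rw [integral_const_mul]
    congr 1
    rw [integral_prod_symm]
    · rw [integral_fintype .of_finite]
      rfl
    · exact integrable_of_abs_le_one (hm.comp measurable_prodMk_left) fun _ => hφ1 _
  · exact integrable_of_abs_le_one ((hφ.comp measurable_fst).mul hm) fun z =>
      abs_mul_le_one' (hφ1 _) (hφ1 _)

lemma resample_discOp (p : ℝ) (B : ι → Bool) {φ : (ι → ℝ) → ℝ} (hφ : Measurable φ)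
    (hφ1 : ∀ x, |φ x| ≤ 1) (x : ι → ℝ) :
    resample B (discOp p φ) x
      = ∑ C : ι → Bool, (berPi ι p).real {C} * resample (fun e => B e && C e) φ x := by
  conv_lhs => rw [resample]
  simp_rw [discOp]
  rw [integral_finsetSum]
  · simp_rw [integral_const_mul, ← resample_resample B _ hφ hφ1 x]
    rfl
  · intro C _
    refine Integrable.const_mul (integrable_of_abs_le_one ?_ fun _ =>
      abs_resample_le_one C hφ1 _) _
    exact (measurable_resample C hφ).comp ((measurable_discPerturb B).comp measurable_prodMk_left)

lemma discOp_discOp {p : ℝ} (h0 : 0 ≤ p) (h1 : p ≤ 1) {φ : (ι → ℝ) → ℝ} (hφ : Measurable φ)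
    (hφ1 : ∀ x, |φ x| ≤ 1) (x : ι → ℝ) :
    discOp p (discOp p φ) x = discOp (p * p) φ x := by
  have hand : Measurable fun (B : (ι → Bool) × (ι → Bool)) e => B.1 e && B.2 e :=
    measurable_of_finite _
  conv_lhs => rw [discOp]
  simp_rw [resample_discOp p _ hφ hφ1 x]
  have hR : discOp (p * p) φ x = ∫ B, resample B φ x ∂berPi ι (p * p) := by
    rw [integral_fintype .of_finite]
    rfl
  rw [hR, ← map_and_berPi h0 h1, integral_map hand.aemeasurable
    (measurable_of_finite _).aestronglyMeasurable, integral_prod _ .of_finite,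
    integral_fintype .of_finite]
  refine Finset.sum_congr rfl fun B _ => ?_
  rw [integral_fintype .of_finite]
  rfl

lemma sq_discCorr_le {p : ℝ} (h0 : 0 ≤ p) (h1 : p ≤ 1) {φ : (ι → ℝ) → ℝ} (hφ : Measurable φ)
    (hφ1 : ∀ x, |φ x| ≤ 1) : discCorr p φ ^ 2 ≤ discCorr (p * p) φ := by
  rw [discCorr_eq p hφ hφ1, discCorr_eq (p * p) hφ hφ1]
  refine sq_integral_mul_le hφ (measurable_discOp p hφ) hφ1 (abs_discOp_le_one h0 h1 hφ1) ?_
  simp_rw [← discOp_discOp h0 h1 hφ hφ1]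
  rw [integral_mul_discOp p hφ (measurable_discOp p hφ) hφ1 (abs_discOp_le_one h0 h1 hφ1),
    integral_mul_discOp p (measurable_discOp p hφ) hφ (abs_discOp_le_one h0 h1 hφ1) hφ1]
  simp_rw [integral_mul_resample _ hφ (measurable_discOp p hφ) hφ1 (abs_discOp_le_one h0 h1 hφ1)]

/-- Decay of two-point correlations under the discrete perturbation. -/
lemma discCorr_twoPoint_le {Edges : Finset (Finset (Fin N))} {ρ : ℕ → ℝ → ℝ}
    (hρ : ∀ p, Measurable (ρ p)) (heven : ∀ e ∈ Edges, Even e.card)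
    (hodd : ∀ p x, ρ p (-x) = - ρ p x) (β : ℝ)
    {i j : Fin N} {d : ℕ} (hd : (d : ℕ∞) ≤ hdist Edges i j) {t : ℝ} (ht : 0 < t) :
    discCorr (Real.exp (-t)) (twoPoint Edges ρ β i j) ≤ Real.exp (-t * d) := by
  have hφ := measurable_twoPoint Edges hρ β i j
  have hφ1 := abs_twoPoint_le_one Edges ρ β i j
  refine le_exp_neg_of_sq_le (g := fun t => discCorr (Real.exp (-t)) (twoPoint Edges ρ β i j))
    (C := Fintype.card (Finset (Fin N) → Bool)) (T₀ := 0) (fun s hs => ?_) (fun T hT => ?_) ht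
  · have := sq_discCorr_le (Real.exp_pos (-s)).le (Real.exp_le_one_iff.2 (by linarith)) hφ hφ1
    rw [← Real.exp_add] at this
    convert this using 3
    ring
  · have h0 := (Real.exp_pos (-T)).le
    have h1 : Real.exp (-T) ≤ 1 := Real.exp_le_one_iff.2 (by linarith)
    rw [discCorr_eq _ hφ hφ1, integral_mul_discOp _ hφ hφ hφ1 hφ1]
    have hexp : Real.exp (-T * d) = Real.exp (-T) ^ d := by
      rw [← Real.exp_nat_mul]; ring_nf
    calc _ ≤ ∑ B : Finset (Fin N) → Bool, Real.exp (-T) ^ d := by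
          refine Finset.sum_le_sum fun B _ => ?_
          by_cases hB : d ≤ (univ.filter fun e => B e = true).card
          · have h2 := abs_integral_le_one (μ := gaussianPi (Finset (Fin N))) fun x =>
              abs_mul_le_one' (hφ1 x) (abs_resample_le_one B hφ1 x)
            exact (mul_le_of_le_one_right measureReal_nonneg (abs_le.1 h2).2).trans
              (berPi_real_le h0 h1 B hB)
          · rw [integral_twoPoint_mul_eq_zero hρ heven hodd β hd _ (not_le.1 hB)
              (measurable_resample B hφ)]
            · rw [mul_zero]; positivity
            · intro x y hxy
              unfold resample
              congr 1
              funext z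
              congr 1
              funext e
              simp only [discPerturb]
              split_ifs with hBe
              · exact hxy e (by simp [hBe])
              · rfl
      _ = _ := by rw [hexp]; simp

end

/-- The reflection of a pair of vectors with first row `(a, b)`. -/
def reflect {ι : Type*} (a b : ℝ) (z : (ι → ℝ) × (ι → ℝ)) : (ι → ℝ) × (ι → ℝ) :=
  (fun e => a * z.1 e + b * z.2 e, fun e => b * z.1 e - a * z.2 e)

lemma measurable_reflect {ι : Type*} (a b : ℝ) : Measurable (reflect (ι := ι) a b) := by
  unfold reflect
  fun_prop

lemma map_reflect_gaussianReal {a b : ℝ} (hb : 0 ≤ b) (hab : a ^ 2 + b ^ 2 = 1) :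
    ((gaussianReal 0 1).prod (gaussianReal 0 1)).map
      (fun z : ℝ × ℝ => (a * z.1 + b * z.2, b * z.1 - a * z.2))
      = (gaussianReal 0 1).prod (gaussianReal 0 1) := by
  have hrot := IsGaussian.map_rotation_eq_self (μ := gaussianReal 0 1) (by simp) (arccos a)
  have hneg : ((gaussianReal 0 1).prod (gaussianReal 0 1)).map (Prod.map id fun y : ℝ => -y)
      = (gaussianReal 0 1).prod (gaussianReal 0 1) := by
    rw [← Measure.map_prod_map _ _ measurable_id measurable_neg, Measure.map_id,
      gaussianReal_map_neg, neg_zero]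
  conv_rhs => rw [← hneg, ← hrot]
  rw [Measure.map_map (by fun_prop) (ContinuousLinearMap.measurable _)]
  congr 1
  funext z
  have ha1 : -1 ≤ a := by nlinarith
  have ha2 : a ≤ 1 := by nlinarith
  have hs : √(1 - a ^ 2) = b := by rw [← hab, add_sub_cancel_left, sqrt_sq hb]
  simp only [Function.comp, ContinuousLinearMap.rotation_apply, Prod.map, id,
    Real.cos_arccos ha1 ha2, Real.sin_arccos, hs, smul_eq_mul]
  refine Prod.ext rfl ?_
  ring

lemma measurable_contPerturb {ι : Type*} (t : ℝ) :
    Measurable fun z : (ι → ℝ) × (ι → ℝ) => contPerturb t z.1 z.2 := by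
  unfold contPerturb
  fun_prop

section

variable {ι : Type*} [Fintype ι]

lemma map_reflect_gaussianPi {a b : ℝ} (hb : 0 ≤ b) (hab : a ^ 2 + b ^ 2 = 1) :
    ((gaussianPi ι).prod (gaussianPi ι)).map (reflect a b)
      = (gaussianPi ι).prod (gaussianPi ι) := by
  have hE := (measurePreserving_arrowProdEquivProdArrow ℝ ℝ ι
    (fun _ => gaussianReal 0 1) (fun _ => gaussianReal 0 1)).map_eq
  have h := map_pi_prod_pi (ι := ι) (gaussianReal 0 1) (gaussianReal 0 1)
    (f := fun z : ℝ × ℝ => (a * z.1 + b * z.2, b * z.1 - a * z.2)) (by fun_prop) _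
    (map_reflect_gaussianReal hb hab)
  unfold gaussianPi
  conv_rhs => rw [← hE, ← h]
  rw [Measure.map_map (MeasurableEquiv.measurable _) (by fun_prop)]
  rfl

/-- The Ornstein–Uhlenbeck operator. -/
def contOp (t : ℝ) (φ : (ι → ℝ) → ℝ) (x : ι → ℝ) : ℝ :=
  ∫ y, φ (contPerturb t x y) ∂gaussianPi ι

lemma measurable_contOp (t : ℝ) {φ : (ι → ℝ) → ℝ} (hφ : Measurable φ) :
    Measurable (contOp t φ) :=
  (StronglyMeasurable.integral_prod_right'
    (hφ.comp (measurable_contPerturb t)).stronglyMeasurable).measurable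

lemma abs_contOp_le_one (t : ℝ) {φ : (ι → ℝ) → ℝ} (h1 : ∀ x, |φ x| ≤ 1) (x : ι → ℝ) :
    |contOp t φ x| ≤ 1 :=
  abs_integral_le_one fun _ => h1 _

lemma integral_mul_contOp (t : ℝ) {φ ψ : (ι → ℝ) → ℝ} (hφ : Measurable φ)
    (hψ : Measurable ψ) (hφ1 : ∀ x, |φ x| ≤ 1) (hψ1 : ∀ x, |ψ x| ≤ 1) :
    ∫ x, φ x * contOp t ψ x ∂gaussianPi ι
      = ∫ z, φ z.1 * ψ (contPerturb t z.1 z.2) ∂(gaussianPi ι).prod (gaussianPi ι) := by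
  rw [integral_prod]
  · simp_rw [integral_const_mul]
    rfl
  · exact integrable_of_abs_le_one ((hφ.comp measurable_fst).mul
      (hψ.comp (measurable_contPerturb t))) fun z => abs_mul_le_one' (hφ1 _) (hψ1 _)

lemma sq_exp_add_sq_sqrt {t : ℝ} (ht : 0 ≤ t) :
    Real.exp (-t) ^ 2 + √(1 - Real.exp (-2 * t)) ^ 2 = 1 := by
  rw [sq_sqrt (sub_nonneg.2 (Real.exp_le_one_iff.2 (by linarith))), ← Real.exp_nat_mul]
  ring_nf

lemma integral_mul_contOp_comm {t : ℝ} (ht : 0 ≤ t) {φ ψ : (ι → ℝ) → ℝ} (hφ : Measurable φ)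
    (hψ : Measurable ψ) (hφ1 : ∀ x, |φ x| ≤ 1) (hψ1 : ∀ x, |ψ x| ≤ 1) :
    ∫ x, φ x * contOp t ψ x ∂gaussianPi ι = ∫ x, ψ x * contOp t φ x ∂gaussianPi ι := by
  rw [integral_mul_contOp t hφ hψ hφ1 hψ1, integral_mul_contOp t hψ hφ hψ1 hφ1]
  have hm : Measurable fun z : (ι → ℝ) × (ι → ℝ) => φ z.1 * ψ (contPerturb t z.1 z.2) :=
    (hφ.comp measurable_fst).mul (hψ.comp (measurable_contPerturb t))
  have hab := sq_exp_add_sq_sqrt ht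
  set r := Real.exp (-t) with hr
  set s := √(1 - Real.exp (-2 * t)) with hs
  have hs0 : 0 ≤ s := sqrt_nonneg _
  conv_lhs => rw [← map_reflect_gaussianPi hs0 hab]
  rw [integral_map (measurable_reflect _ _).aemeasurable hm.aestronglyMeasurable]
  refine integral_congr_ae (.of_forall fun z => ?_)
  have h1 : contPerturb t (reflect r s z).1 (reflect r s z).2 = z.1 := by
    funext e
    simp only [contPerturb, reflect, ← hr, ← hs]
    linear_combination z.1 e * hab
  have h2 : (reflect r s z).1 = contPerturb t z.1 z.2 := rfl
  dsimp only
  rw [h1, h2, mul_comm]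

lemma contOp_contOp {t : ℝ} (ht : 0 < t) {φ : (ι → ℝ) → ℝ} (hφ : Measurable φ)
    (hφ1 : ∀ x, |φ x| ≤ 1) (x : ι → ℝ) :
    contOp t (contOp t φ) x = contOp (2 * t) φ x := by
  have h1 := sq_exp_add_sq_sqrt ht.le
  have h2 := sq_exp_add_sq_sqrt (t := 2 * t) (by positivity)
  have hrr : Real.exp (-(2 * t)) = Real.exp (-t) ^ 2 := by
    rw [← Real.exp_nat_mul]; ring_nf
  have hs'pos : 0 < √(1 - Real.exp (-2 * (2 * t))) :=
    sqrt_pos.2 (sub_pos.2 (Real.exp_lt_one_iff.2 (by linarith)))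
  have hs0 : 0 ≤ √(1 - Real.exp (-2 * t)) := sqrt_nonneg _
  set r := Real.exp (-t) with hr
  set s := √(1 - Real.exp (-2 * t)) with hs
  set s' := √(1 - Real.exp (-2 * (2 * t))) with hs'
  rw [hrr] at h2
  have hab : (r * s / s') ^ 2 + (s / s') ^ 2 = 1 := by
    rw [div_pow, div_pow, ← add_div, div_eq_one_iff_eq (by positivity)]
    linear_combination (1 + r ^ 2) * h1 - h2
  have hc : ∀ y y' : ι → ℝ, contPerturb t (contPerturb t x y) y'
      = contPerturb (2 * t) x (reflect (r * s / s') (s / s') (y, y')).1 := by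
    intro y y'
    funext e
    simp only [contPerturb, reflect, ← hr, ← hs, ← hs', hrr]
    field_simp
    ring
  have hdx : Measurable fun y => contPerturb (2 * t) x y :=
    (measurable_contPerturb _).comp measurable_prodMk_left
  have hm : Measurable fun z : (ι → ℝ) × (ι → ℝ) => φ (contPerturb (2 * t) x z.1) :=
    hφ.comp (hdx.comp measurable_fst)
  unfold contOp
  simp_rw [hc]
  rw [← integral_prod (fun z : (ι → ℝ) × (ι → ℝ) =>
      φ (contPerturb (2 * t) x (reflect (r * s / s') (s / s') z).1))]
  · rw [← integral_map (φ := reflect (r * s / s') (s / s'))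
      (f := fun z => φ (contPerturb (2 * t) x z.1))
      (measurable_reflect _ _).aemeasurable hm.aestronglyMeasurable,
      map_reflect_gaussianPi (by positivity) hab, integral_prod]
    · simp
    · exact integrable_of_abs_le_one hm fun _ => hφ1 _
  · exact integrable_of_abs_le_one (hm.comp (measurable_reflect _ _)) fun _ => hφ1 _

/-- The correlation `E[φ(J) φ(J(t))]` under the continuous perturbation. -/
def contCorr (t : ℝ) (φ : (ι → ℝ) → ℝ) : ℝ :=
  ∫ ω : (ι → ℝ) × (ι → ℝ), φ ω.1 * φ (contPerturb t ω.1 ω.2) ∂pairGauss ι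

lemma sq_contCorr_le {t : ℝ} (ht : 0 < t) {φ : (ι → ℝ) → ℝ} (hφ : Measurable φ)
    (hφ1 : ∀ x, |φ x| ≤ 1) : contCorr t φ ^ 2 ≤ contCorr (2 * t) φ := by
  unfold contCorr pairGauss
  rw [← integral_mul_contOp t hφ hφ hφ1 hφ1, ← integral_mul_contOp (2 * t) hφ hφ hφ1 hφ1]
  refine sq_integral_mul_le hφ (measurable_contOp t hφ) hφ1 (abs_contOp_le_one t hφ1) ?_
  simp_rw [← contOp_contOp ht hφ hφ1]
  exact integral_mul_contOp_comm ht.le hφ (measurable_contOp t hφ) hφ1 (abs_contOp_le_one t hφ1)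

end

/-- The Mehler kernel: the density of a standard Gaussian pair with correlation `r` with respect
to the independent one. -/
def mehlerKer (r : ℝ) (z : ℝ × ℝ) : ℝ :=
  (√(1 - r ^ 2))⁻¹ *
    Real.exp ((2 * r * z.1 * z.2 - r ^ 2 * (z.1 ^ 2 + z.2 ^ 2)) / (2 * (1 - r ^ 2)))

lemma measurable_mehlerKer (r : ℝ) : Measurable (mehlerKer r) := by
  unfold mehlerKer
  fun_prop

lemma mehlerKer_nonneg (r : ℝ) (z : ℝ × ℝ) : 0 ≤ mehlerKer r z := by
  unfold mehlerKer
  positivity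

lemma gaussianPDFReal_eq_mul_mehlerKer {r : ℝ} {v : NNReal} (hv : (v : ℝ) = 1 - r ^ 2)
    (hv0 : 0 < (v : ℝ)) (x y : ℝ) :
    gaussianPDFReal (r * x) v y = gaussianPDFReal 0 1 y * mehlerKer r (x, y) := by
  simp only [gaussianPDFReal_def, mehlerKer, ← hv]
  rw [sqrt_mul (by positivity), mul_inv, mul_mul_mul_comm, ← Real.exp_add]
  simp only [NNReal.coe_one, mul_one]
  congr 2
  field_simp
  rw [hv]
  ring

lemma map_gaussianReal_eq_withDensity {r : ℝ} (hr : r ^ 2 < 1) (x : ℝ) :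
    (gaussianReal 0 1).map (fun y => r * x + √(1 - r ^ 2) * y)
      = (gaussianReal 0 1).withDensity fun y => ENNReal.ofReal (mehlerKer r (x, y)) := by
  have hv0 : 0 < 1 - r ^ 2 := by linarith
  have hcomp : (fun y => r * x + √(1 - r ^ 2) * y)
      = (fun y => r * x + y) ∘ fun y => √(1 - r ^ 2) * y := rfl
  rw [hcomp, ← Measure.map_map (by fun_prop) (by fun_prop), gaussianReal_map_const_mul,
    gaussianReal_map_const_add]
  set v : NNReal := NNReal.mk (√(1 - r ^ 2) ^ 2) (sq_nonneg _) * 1 with hvdef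
  have hv : (v : ℝ) = 1 - r ^ 2 := by
    simp [hvdef, sq_sqrt hv0.le]
  have hvne : v ≠ 0 := fun h => by
    rw [h] at hv; simp at hv; linarith
  have hK : Measurable fun y => ENNReal.ofReal (mehlerKer r (x, y)) :=
    ((measurable_mehlerKer r).comp measurable_prodMk_left).ennreal_ofReal
  rw [gaussianReal_of_var_ne_zero _ hvne, gaussianReal_of_var_ne_zero _ one_ne_zero,
    ← withDensity_mul _ (by fun_prop) hK]
  congr 1
  funext y
  simp only [gaussianPDF, Pi.mul_apply, mul_zero, zero_add]
  rw [← ENNReal.ofReal_mul (gaussianPDFReal_nonneg _ _ _),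
    ← gaussianPDFReal_eq_mul_mehlerKer hv (hv ▸ hv0)]

lemma map_prod_gaussianReal_eq_withDensity {r : ℝ} (hr : r ^ 2 < 1) :
    ((gaussianReal 0 1).prod (gaussianReal 0 1)).map
      (fun z : ℝ × ℝ => (z.1, r * z.1 + √(1 - r ^ 2) * z.2))
      = ((gaussianReal 0 1).prod (gaussianReal 0 1)).withDensity
        fun z => ENNReal.ofReal (mehlerKer r z) := by
  have hK := (measurable_mehlerKer r).ennreal_ofReal
  refine Measure.ext_of_lintegral _ fun f hf => ?_
  rw [lintegral_map hf (by fun_prop), lintegral_prod _ (by fun_prop),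
    lintegral_withDensity_eq_lintegral_mul _ hK hf, lintegral_prod _ (by fun_prop)]
  refine lintegral_congr fun x => ?_
  have hKx : Measurable fun y => ENNReal.ofReal (mehlerKer r (x, y)) :=
    hK.comp measurable_prodMk_left
  rw [← lintegral_map (f := fun y => f (x, y)) (by fun_prop) (by fun_prop),
    map_gaussianReal_eq_withDensity hr, lintegral_withDensity_eq_lintegral_mul _ hKx
      (by fun_prop)]
  rfl

lemma pi_withDensity {ι X : Type*} [Fintype ι] [MeasurableSpace X] {μ : Measure X}
    [IsFiniteMeasure μ] {g : X → ℝ} (hg0 : ∀ x, 0 ≤ g x)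
    (hgi : Integrable g μ) :
    Measure.pi (fun _ : ι => μ.withDensity fun x => ENNReal.ofReal (g x))
      = (Measure.pi fun _ : ι => μ).withDensity fun x => ENNReal.ofReal (∏ e, g (x e)) := by
  have := isFiniteMeasure_withDensity_ofReal hgi.2
  refine Measure.pi_eq fun s hs => ?_
  rw [withDensity_apply _ (MeasurableSet.univ_pi hs), Measure.restrict_pi_pi,
    ← ofReal_integral_eq_lintegral_ofReal (Integrable.fintype_prod fun e => hgi.restrict)
      (.of_forall fun x => prod_nonneg fun e _ => hg0 _),
    integral_fintype_prod_eq_prod (f := fun _ x => g x),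
    ENNReal.ofReal_prod_of_nonneg fun e _ => integral_nonneg hg0]
  refine Finset.prod_congr rfl fun e _ => ?_
  rw [withDensity_apply _ (hs e), ofReal_integral_eq_lintegral_ofReal hgi.restrict
    (.of_forall hg0)]

lemma integrable_mehlerKer {r : ℝ} (hr : r ^ 2 < 1) :
    Integrable (mehlerKer r) ((gaussianReal 0 1).prod (gaussianReal 0 1)) := by
  refine ⟨(measurable_mehlerKer r).aestronglyMeasurable, ?_⟩
  rw [hasFiniteIntegral_iff_ofReal (.of_forall (mehlerKer_nonneg r)), ← setLIntegral_univ,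
    ← withDensity_apply _ MeasurableSet.univ, ← map_prod_gaussianReal_eq_withDensity hr]
  exact measure_lt_top _ _

section

variable {ι : Type*} [Fintype ι]

lemma contCorr_eq_integral_mehlerKer {t : ℝ} (ht : 0 < t) {φ : (ι → ℝ) → ℝ}
    (hφ : Measurable φ) :
    contCorr t φ = ∫ z : (ι → ℝ) × (ι → ℝ),
      φ z.1 * φ z.2 * ∏ e, mehlerKer (Real.exp (-t)) (z.1 e, z.2 e) ∂pairGauss ι := by
  set r := Real.exp (-t) with hr
  have hrr : Real.exp (-2 * t) = r ^ 2 := by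
    rw [hr, ← Real.exp_nat_mul]; ring_nf
  have hr1 : r ^ 2 < 1 := by
    rw [← hrr]; exact Real.exp_lt_one_iff.2 (by linarith)
  have hE := measurePreserving_arrowProdEquivProdArrow ℝ ℝ ι
    (fun _ => gaussianReal 0 1) (fun _ => gaussianReal 0 1)
  have := isFiniteMeasure_withDensity_ofReal (integrable_mehlerKer hr1).2
  have h := map_pi_prod_pi (ι := ι) (gaussianReal 0 1) (gaussianReal 0 1)
    (f := fun z : ℝ × ℝ => (z.1, r * z.1 + √(1 - r ^ 2) * z.2)) (by fun_prop) _
    (map_prod_gaussianReal_eq_withDensity hr1)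
  rw [pi_withDensity (mehlerKer_nonneg r) (integrable_mehlerKer hr1)] at h
  have hK := measurable_mehlerKer r
  have hF : Measurable fun w : ι → ℝ × ℝ => φ (fun e => (w e).1) * φ (fun e => (w e).2) :=
    (hφ.comp (by fun_prop)).mul (hφ.comp (by fun_prop))
  unfold contCorr pairGauss gaussianPi
  rw [← hE.integral_comp' (fun z : (ι → ℝ) × (ι → ℝ) =>
    φ z.1 * φ z.2 * ∏ e, mehlerKer r (z.1 e, z.2 e))]
  calc _ = ∫ z : (ι → ℝ) × (ι → ℝ), (fun w : ι → ℝ × ℝ =>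
        φ (fun e => (w e).1) * φ (fun e => (w e).2))
          (fun e => (z.1 e, r * z.1 e + √(1 - r ^ 2) * z.2 e))
        ∂(Measure.pi fun _ => gaussianReal 0 1).prod (Measure.pi fun _ => gaussianReal 0 1) := by
        simp only [← hrr]; rfl
    _ = _ := by
        rw [← integral_map (φ := fun (z : (ι → ℝ) × (ι → ℝ)) e =>
          (z.1 e, r * z.1 e + √(1 - r ^ 2) * z.2 e)) (by fun_prop) hF.aestronglyMeasurable, h,
          integral_withDensity_eq_integral_toReal_smul (by fun_prop) (by simp)]
        refine integral_congr_ae (.of_forall fun w => ?_)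
        dsimp only
        rw [ENNReal.toReal_ofReal (prod_nonneg fun e _ => mehlerKer_nonneg r _), smul_eq_mul,
          mul_comm]
        rfl

end

lemma abs_exp_sub_one_le_mul_exp (u : ℝ) : |Real.exp u - 1| ≤ |u| * Real.exp |u| := by
  have h1 := Real.add_one_le_exp (-u)
  have h2 := Real.add_one_le_exp u
  have h3 : Real.exp u * Real.exp (-u) = 1 := by rw [← Real.exp_add]; simp
  have h4 : u * Real.exp u ≤ |u| * Real.exp |u| :=
    mul_le_mul (le_abs_self u) (Real.exp_le_exp.2 (le_abs_self u)) (Real.exp_pos _).le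
      (abs_nonneg u)
  have h5 : |u| ≤ |u| * Real.exp |u| :=
    le_mul_of_one_le_right (abs_nonneg u) (Real.one_le_exp (abs_nonneg u))
  rw [abs_le]
  constructor
  · linarith [neg_abs_le u]
  · nlinarith [Real.exp_pos u]

lemma abs_mehlerKer_sub_one_le {r : ℝ} (h0 : 0 ≤ r) (h1 : r ≤ 1 / 5) (z : ℝ × ℝ) :
    |mehlerKer r z - 1| ≤ 7 * r * (Real.exp (z.1 ^ 2 / 4) * Real.exp (z.2 ^ 2 / 4)) := by
  obtain ⟨x, y⟩ := z
  have hv : 24 / 25 ≤ 1 - r ^ 2 := by nlinarith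
  have hv1 : 1 - r ^ 2 ≤ 1 := by nlinarith
  set q := x ^ 2 + y ^ 2 with hq
  have hq0 : 0 ≤ q := by positivity
  rw [← Real.exp_add, show x ^ 2 / 4 + y ^ 2 / 4 = q / 4 by rw [hq]; ring]
  set c := (√(1 - r ^ 2))⁻¹ with hc
  set u := (2 * r * x * y - r ^ 2 * q) / (2 * (1 - r ^ 2)) with hu
  change |c * Real.exp u - 1| ≤ _
  have hsq1 : √(1 - r ^ 2) ≤ 1 := sqrt_le_one.2 hv1
  have hsqv : 1 - r ^ 2 ≤ √(1 - r ^ 2) := by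
    refine le_sqrt_of_sq_le ?_
    nlinarith
  have hspos : 0 < √(1 - r ^ 2) := sqrt_pos.2 (by linarith)
  have hc1 : 1 ≤ c := (one_le_inv₀ hspos).2 hsq1
  have hcr : c ≤ 1 + r := by
    rw [hc, inv_le_comm₀ hspos (by linarith)]
    refine le_trans ?_ hsqv
    rw [inv_le_iff_one_le_mul₀ (by linarith)]
    nlinarith
  have hnum : |2 * r * x * y - r ^ 2 * q| ≤ 6 / 5 * (r * q) := by
    have : r ^ 2 * q ≤ 1 / 5 * (r * q) := by nlinarith [mul_nonneg h0 hq0]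
    have h3 : 0 ≤ r ^ 2 * q := by positivity
    have h4 : 0 ≤ r * (x + y) ^ 2 := by positivity
    have h5 : 0 ≤ r * (x - y) ^ 2 := by positivity
    rw [abs_le]
    constructor <;> rw [hq] at * <;> nlinarith
  have huq : |u| ≤ 5 / 8 * (r * q) := by
    rw [hu, abs_div, abs_of_pos (show 0 < 2 * (1 - r ^ 2) by linarith),
      div_le_iff₀ (by linarith)]
    nlinarith [mul_nonneg h0 hq0]
  have hu8 : |u| ≤ q / 8 := by nlinarith
  have hue : |Real.exp u - 1| ≤ 5 * r * Real.exp (q / 4) := by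
    refine (abs_exp_sub_one_le_mul_exp u).trans ?_
    have e1 := Real.add_one_le_exp (q / 8)
    calc |u| * Real.exp |u| ≤ (5 * r * Real.exp (q / 8)) * Real.exp (q / 8) := by
          refine mul_le_mul ?_ (Real.exp_le_exp.2 hu8) (Real.exp_pos _).le (by positivity)
          nlinarith
      _ = _ := by rw [mul_assoc, ← Real.exp_add]; ring_nf
  have hE : 1 ≤ Real.exp (q / 4) := Real.one_le_exp (by positivity)
  calc |c * Real.exp u - 1| = |c * (Real.exp u - 1) + (c - 1)| := by ring_nf
    _ ≤ c * |Real.exp u - 1| + (c - 1) := by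
        refine (abs_add_le _ _).trans ?_
        rw [abs_mul, abs_of_pos (by linarith : 0 < c), abs_of_nonneg (by linarith : 0 ≤ c - 1)]
    _ ≤ 6 / 5 * (5 * r * Real.exp (q / 4)) + r * Real.exp (q / 4) := by
        refine add_le_add (mul_le_mul (by linarith) hue (abs_nonneg _) (by norm_num)) ?_
        nlinarith
    _ = _ := by ring

lemma integrable_exp_sq_div_four :
    Integrable (fun x : ℝ => Real.exp (x ^ 2 / 4)) (gaussianReal 0 1) := by
  rw [gaussianReal_of_var_ne_zero _ one_ne_zero,
    integrable_withDensity_iff_integrable_smul' (by fun_prop) (by simp [gaussianPDF])]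
  have := (integrable_exp_neg_mul_sq (b := 1 / 4) (by norm_num)).const_mul (√(2 * π))⁻¹
  refine this.congr (.of_forall fun x => ?_)
  simp only [toReal_gaussianPDF, gaussianPDFReal_def, smul_eq_mul, NNReal.coe_one, mul_one,
    sub_zero]
  rw [mul_assoc, ← Real.exp_add]
  ring_nf

section

variable {ι : Type*} [Fintype ι]

/-- A weight dominating the correction terms of the Mehler kernel. -/
def gaussWeight (x : ι → ℝ) : ℝ := ∏ e, Real.exp (x e ^ 2 / 4)

lemma integrable_gaussWeight_mul :
    Integrable (fun z : (ι → ℝ) × (ι → ℝ) => gaussWeight z.1 * gaussWeight z.2)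
      (pairGauss ι) :=
  have h : Integrable (gaussWeight (ι := ι)) (gaussianPi ι) :=
    Integrable.fintype_prod fun _ => integrable_exp_sq_div_four
  h.mul_prod h

lemma abs_prod_mehlerKer_sub_one_le {r : ℝ} (h0 : 0 ≤ r) (h1 : r ≤ 1 / 5) (S : Finset ι)
    (z : (ι → ℝ) × (ι → ℝ)) :
    |∏ e ∈ S, (mehlerKer r (z.1 e, z.2 e) - 1)|
      ≤ (7 * r) ^ S.card * (gaussWeight z.1 * gaussWeight z.2) := by
  rw [Finset.abs_prod]
  calc _ ≤ ∏ e ∈ S, 7 * r * (Real.exp (z.1 e ^ 2 / 4) * Real.exp (z.2 e ^ 2 / 4)) :=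
        Finset.prod_le_prod (fun _ _ => abs_nonneg _) fun e _ =>
          abs_mehlerKer_sub_one_le h0 h1 _
    _ = (7 * r) ^ S.card * ∏ e ∈ S, (Real.exp (z.1 e ^ 2 / 4) * Real.exp (z.2 e ^ 2 / 4)) := by
        rw [Finset.prod_mul_distrib, Finset.prod_const]
    _ ≤ _ := by
        refine mul_le_mul_of_nonneg_left ?_ (by positivity)
        rw [gaussWeight, gaussWeight, ← Finset.prod_mul_distrib]
        refine Finset.prod_le_prod_of_subset_of_one_le (subset_univ S)
          (fun e _ => by positivity) fun e _ _ => ?_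
        exact one_le_mul_of_one_le_of_one_le (Real.one_le_exp (by positivity))
          (Real.one_le_exp (by positivity))

end

/-- Decay of two-point correlations under the continuous perturbation. -/
lemma contCorr_twoPoint_le {Edges : Finset (Finset (Fin N))} {ρ : ℕ → ℝ → ℝ}
    (hρ : ∀ p, Measurable (ρ p)) (heven : ∀ e ∈ Edges, Even e.card)
    (hodd : ∀ p x, ρ p (-x) = - ρ p x) (β : ℝ)
    {i j : Fin N} {d : ℕ} (hd : (d : ℕ∞) ≤ hdist Edges i j) {t : ℝ} (ht : 0 < t) :
    contCorr t (twoPoint Edges ρ β i j) ≤ Real.exp (-t * d) := by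
  have hφ := measurable_twoPoint Edges hρ β i j
  have hφ1 := abs_twoPoint_le_one Edges ρ β i j
  set φ := twoPoint Edges ρ β i j with hφdef
  set W : ((Finset (Fin N) → ℝ) × (Finset (Fin N) → ℝ)) → ℝ :=
    fun z => gaussWeight z.1 * gaussWeight z.2 with hW
  have hW0 : ∀ z, 0 ≤ W z := fun z => by simp only [hW, gaussWeight]; positivity
  have hWi : Integrable W (pairGauss _) := integrable_gaussWeight_mul
  refine le_exp_neg_of_sq_le (g := fun t => contCorr t φ)
    (C := ∑ S : Finset (Finset (Fin N)), 7 ^ S.card * ∫ z, W z ∂pairGauss _)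
    (T₀ := Real.log 5) (fun s hs => sq_contCorr_le hs hφ hφ1) (fun T hT => ?_) ht
  have hT0 : 0 < T := (Real.log_pos (by norm_num)).trans_le hT
  have hr0 := (Real.exp_pos (-T)).le
  have hr1 : Real.exp (-T) ≤ 1 / 5 := by
    rw [← Real.le_log_iff_exp_le (by norm_num), one_div, Real.log_inv]
    linarith
  have hexp : Real.exp (-T * d) = Real.exp (-T) ^ d := by
    rw [← Real.exp_nat_mul]; ring_nf
  rw [contCorr_eq_integral_mehlerKer hT0 hφ, hexp, Finset.sum_mul]
  set r := Real.exp (-T)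
  have hk := measurable_mehlerKer r
  have hm : ∀ S : Finset (Finset (Fin N)), Measurable
      fun z : (Finset (Fin N) → ℝ) × (Finset (Fin N) → ℝ) =>
        φ z.1 * φ z.2 * ∏ e ∈ S, (mehlerKer r (z.1 e, z.2 e) - 1) := fun S =>
    ((hφ.comp measurable_fst).mul (hφ.comp measurable_snd)).mul (by fun_prop)
  have hle : ∀ (S : Finset (Finset (Fin N))) z,
      ‖φ z.1 * φ z.2 * ∏ e ∈ S, (mehlerKer r (z.1 e, z.2 e) - 1)‖ ≤ (7 * r) ^ S.card * W z :=
    fun S z => by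
      rw [norm_mul, Real.norm_eq_abs, Real.norm_eq_abs]
      exact (mul_le_of_le_one_left (abs_nonneg _) (abs_mul_le_one' (hφ1 _) (hφ1 _))).trans
        (abs_prod_mehlerKer_sub_one_le hr0 hr1 S z)
  have hint : ∀ S : Finset (Finset (Fin N)), Integrable
      (fun z : (Finset (Fin N) → ℝ) × (Finset (Fin N) → ℝ) =>
        φ z.1 * φ z.2 * ∏ e ∈ S, (mehlerKer r (z.1 e, z.2 e) - 1)) (pairGauss _) := fun S =>
    (hWi.const_mul _).mono' (hm S).aestronglyMeasurable (.of_forall (hle S))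
  have hsum : ∀ z : (Finset (Fin N) → ℝ) × (Finset (Fin N) → ℝ),
      φ z.1 * φ z.2 * ∏ e, mehlerKer r (z.1 e, z.2 e)
        = ∑ S, φ z.1 * φ z.2 * ∏ e ∈ S, (mehlerKer r (z.1 e, z.2 e) - 1) := fun z => by
    rw [← Finset.mul_sum]
    congr 1
    simpa using Finset.prod_one_add (f := fun e => mehlerKer r (z.1 e, z.2 e) - 1) univ
  simp_rw [hsum]
  rw [integral_finsetSum _ fun S _ => hint S]
  refine Finset.sum_le_sum fun S _ => ?_
  by_cases hS : d ≤ S.card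
  · refine (le_abs_self _).trans ((norm_integral_le_of_norm_le (hWi.const_mul _)
      (.of_forall (hle S))).trans ?_)
    rw [integral_const_mul, mul_pow, mul_right_comm]
    have hWI : 0 ≤ ∫ z, W z ∂pairGauss (Finset (Fin N)) := integral_nonneg hW0
    have := pow_le_pow_of_le_one hr0 (by linarith) hS
    gcongr
  · have h0 : ∀ y : Finset (Fin N) → ℝ,
        ∫ x, φ x * φ y * ∏ e ∈ S, (mehlerKer r (x e, y e) - 1)
          ∂gaussianPi (Finset (Fin N)) = 0 := fun y => by
      have := integral_twoPoint_mul_eq_zero hρ heven hodd β hd S (not_le.1 hS)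
        (F := fun x => φ y * ∏ e ∈ S, (mehlerKer r (x e, y e) - 1)) (by fun_prop)
        fun x x' hx => by
          congr 1
          exact Finset.prod_congr rfl fun e he => by rw [hx e he]
      simpa only [mul_assoc] using this
    rw [pairGauss, integral_prod_symm _ (hint S)]
    simp only [h0, integral_zero]
    have hWI : 0 ≤ ∫ z, W z ∂pairGauss (Finset (Fin N)) := integral_nonneg hW0
    positivity

lemma gibbs2_sum (β : ℝ) (H₁ H₂ : (Fin N → Bool) → ℝ) {κ : Type*} (s : Finset κ)
    (F : κ → (Fin N → Bool) → (Fin N → Bool) → ℝ) :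
    gibbs2 β H₁ H₂ (fun σ τ => ∑ k ∈ s, F k σ τ) = ∑ k ∈ s, gibbs2 β H₁ H₂ (F k) := by
  simp only [gibbs2, ← Finset.sum_div, Finset.sum_mul]
  congr 1
  rw [Finset.sum_comm (s := s)]
  exact Finset.sum_congr rfl fun σ _ => Finset.sum_comm

lemma gibbs2_mul (β : ℝ) (H₁ H₂ : (Fin N → Bool) → ℝ) (f g : (Fin N → Bool) → ℝ) :
    gibbs2 β H₁ H₂ (fun σ τ => f σ * g τ) = gibbs β H₁ f * gibbs β H₂ g := by
  simp only [gibbs2, gibbs, div_mul_div_comm, Finset.sum_mul_sum, Real.exp_add,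
    mul_mul_mul_comm]

lemma gibbs2_overlap_sq (β : ℝ) (H₁ H₂ : (Fin N → Bool) → ℝ) :
    gibbs2 β H₁ H₂ (fun σ τ => overlap σ τ ^ 2)
      = (∑ p : Fin N × Fin N, gibbs β H₁ (fun σ => spin (σ p.1) * spin (σ p.2)) *
          gibbs β H₂ (fun σ => spin (σ p.1) * spin (σ p.2))) / (N : ℝ) ^ 2 := by
  have h : (fun σ τ : Fin N → Bool => overlap σ τ ^ 2) = fun σ τ =>
      ∑ p : Fin N × Fin N, (spin (σ p.1) * spin (σ p.2) / (N : ℝ) ^ 2) *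
        (spin (τ p.1) * spin (τ p.2)) := by
    funext σ τ
    rw [overlap, div_pow, sq (∑ i, _), Finset.sum_mul_sum, Fintype.sum_prod_type,
      Finset.sum_div]
    simp_rw [Finset.sum_div]
    refine Finset.sum_congr rfl fun i _ => Finset.sum_congr rfl fun j _ => ?_
    ring
  rw [h, gibbs2_sum, Finset.sum_div]
  refine Finset.sum_congr rfl fun p _ => ?_
  rw [gibbs2_mul β H₁ H₂ (fun σ => spin (σ p.1) * spin (σ p.2) / (N : ℝ) ^ 2), mul_div_right_comm]
  congr 1
  simp only [gibbs, div_mul_eq_mul_div, Finset.sum_div, div_right_comm]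

lemma contExp_overlap_sq (Edges : Finset (Finset (Fin N))) {ρ : ℕ → ℝ → ℝ}
    (hρ : ∀ p, Measurable (ρ p)) (β t : ℝ) :
    contExp Edges ρ β t (fun σ τ => overlap σ τ ^ 2)
      = (∑ p : Fin N × Fin N, contCorr t (twoPoint Edges ρ β p.1 p.2)) / (N : ℝ) ^ 2 := by
  simp only [contExp, gibbs2_overlap_sq]
  rw [integral_div, integral_finsetSum]
  · rfl
  · exact fun p _ => integrable_of_abs_le_one (μ := (gaussianPi _).prod (gaussianPi _))
      (((measurable_twoPoint Edges hρ β p.1 p.2).comp measurable_fst).mul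
        ((measurable_twoPoint Edges hρ β p.1 p.2).comp (measurable_contPerturb t)))
      fun _ => abs_mul_le_one' (abs_twoPoint_le_one ..) (abs_twoPoint_le_one ..)

lemma discExp_overlap_sq (Edges : Finset (Finset (Fin N))) {ρ : ℕ → ℝ → ℝ}
    (hρ : ∀ p, Measurable (ρ p)) (β t : ℝ) :
    discExp Edges ρ β t (fun σ τ => overlap σ τ ^ 2)
      = (∑ p : Fin N × Fin N, discCorr (Real.exp (-t)) (twoPoint Edges ρ β p.1 p.2))
        / (N : ℝ) ^ 2 := by
  simp only [discExp, gibbs2_overlap_sq]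
  rw [integral_div, integral_finsetSum]
  · rfl
  · exact fun p _ => integrable_of_abs_le_one
      (μ := (gaussianPi _).prod ((gaussianPi _).prod (berPi _ _)))
      (((measurable_twoPoint Edges hρ β p.1 p.2).comp measurable_fst).mul
        ((measurable_twoPoint Edges hρ β p.1 p.2).comp measurable_discPerturb_joint))
      fun _ => abs_mul_le_one' (abs_twoPoint_le_one ..) (abs_twoPoint_le_one ..)

/-- Exponential decay of correlations in the hypergraph distance, combined with exponential
volume growth, gives a polynomial bound on the averaged correlation. -/
lemma sum_div_sq_le_of_decay {A γ : ℝ} (hA : 0 < A) (hγ : 1 < γ) (hN : 1 ≤ N)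
    {Edges : Finset (Finset (Fin N))}
    (hvol : ∀ r : ℕ, 1 ≤ r → ∀ i : Fin N, ((hball Edges i r).card : ℝ) ≤ A * γ ^ r)
    {t : ℝ} (ht : 0 < t) {c : Fin N × Fin N → ℝ}
    (hc : ∀ i j, ∀ d : ℕ, (d : ℕ∞) ≤ hdist Edges i j → c (i, j) ≤ Real.exp (-t * d)) :
    (∑ p, c p) / (N : ℝ) ^ 2 ≤ (A * γ + 1) / (N : ℝ) ^ (t / (t + Real.log γ)) := by
  classical
  have hL := Real.log_pos hγ
  have hN0 : 0 < (N : ℝ) := by exact_mod_cast hN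
  set L := Real.log γ
  set x := Real.log N / (t + L) with hx
  have hx0 : 0 ≤ x := div_nonneg (Real.log_natCast_nonneg N) (by positivity)
  have hlogN : x * L - t * x + 2 * (t * x) = Real.log N := by
    rw [hx]; field_simp; ring
  have hpow : (N : ℝ) ^ (t / (t + L)) = Real.exp (t * x) := by
    rw [Real.rpow_def_of_pos hN0, hx]; ring_nf
  have hrow : ∀ i, ∑ j, c (i, j) ≤ (A * γ + 1) * (N * Real.exp (-(t * x))) := by
    intro i
    set r := ⌊x⌋₊
    have hcard : ((hball Edges i r).card : ℝ) ≤ A * γ * (N * Real.exp (-(t * x))) := by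
      have hmono : (hball Edges i r).card ≤ (hball Edges i (r + 1)).card := by
        refine Finset.card_le_card (Finset.monotone_filter_right _ fun j _ hj => hj.trans ?_)
        exact_mod_cast r.le_succ
      have hγr : γ ^ r ≤ N * Real.exp (-(t * x)) := by
        rw [← Real.exp_log hN0, ← Real.exp_add, ← hlogN, ← Real.exp_log (zero_lt_one.trans hγ),
          ← Real.exp_nat_mul]
        refine Real.exp_le_exp.2 ?_
        have := mul_le_mul_of_nonneg_right (Nat.floor_le hx0) hL.le
        linarith
      calc ((hball Edges i r).card : ℝ) ≤ (hball Edges i (r + 1)).card := by exact_mod_cast hmono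
        _ ≤ A * γ ^ (r + 1) := hvol _ (by lia) i
        _ = A * γ * γ ^ r := by ring
        _ ≤ _ := mul_le_mul_of_nonneg_left hγr (by positivity)
    calc ∑ j, c (i, j)
        ≤ ∑ j, ((if j ∈ hball Edges i r then 1 else 0) + Real.exp (-(t * x))) := by
          refine Finset.sum_le_sum fun j _ => ?_
          split_ifs with hj
          · have := hc i j 0 (by simp)
            simp only [CharP.cast_eq_zero, mul_zero, Real.exp_zero] at this
            linarith [Real.exp_pos (-(t * x))]
          · have hlt : (r : ℕ∞) < hdist Edges i j := by simpa [hball] using hj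
            have := hc i j (r + 1) (by exact_mod_cast Order.add_one_le_of_lt hlt)
            refine this.trans ?_
            rw [zero_add]
            refine Real.exp_le_exp.2 ?_
            have := mul_le_mul_of_nonneg_left (Nat.lt_floor_add_one x).le ht.le
            push_cast
            linarith
      _ = (hball Edges i r).card + N * Real.exp (-(t * x)) := by
          simp [Finset.sum_add_distrib]
      _ ≤ _ := by linarith
  rw [hpow, Fintype.sum_prod_type, div_eq_mul_inv (A * γ + 1), ← Real.exp_neg,
    div_le_iff₀ (by positivity)]
  calc ∑ i, ∑ j, c (i, j) ≤ ∑ _i : Fin N, (A * γ + 1) * (N * Real.exp (-(t * x))) :=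
        Finset.sum_le_sum fun i _ => hrow i
    _ = _ := by
        simp only [Finset.sum_const, Finset.card_univ, Fintype.card_fin, nsmul_eq_mul]
        ring

/-- Under exponential volume growth `max_i |B_r(i)| ≤ A γ^r` with `γ > 1`,
there is a constant `C = C(A,γ) > 0` such that for both perturbations and all `t > 0`,
`0 ≤ β < ∞`, `E⟨R(σ,τ)²⟩_t ≤ C / N^{t/(t+log γ)}`. -/
theorem stmt8 (A γ : ℝ) (hA : 0 < A) (hγ : 1 < γ) :
    ∃ C > 0, ∀ (N Δ : ℕ), 1 ≤ N → 2 ≤ Δ →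
      ∀ Edges : Finset (Finset (Fin N)),
        (∀ e ∈ Edges, 2 ≤ e.card ∧ e.card ≤ Δ) → (∀ e ∈ Edges, Even e.card) →
      ∀ ρ : ℕ → ℝ → ℝ, (∀ p, Measurable (ρ p)) → (∀ p x, ρ p (-x) = - ρ p x) →
      (∀ r : ℕ, 1 ≤ r → ∀ i : Fin N, ((hball Edges i r).card : ℝ) ≤ A * γ ^ r) →
      ∀ t β : ℝ, 0 < t → 0 ≤ β →
        contExp Edges ρ β t (fun σ τ => overlap σ τ ^ 2)
            ≤ C / (N : ℝ) ^ (t / (t + Real.log γ)) ∧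
          discExp Edges ρ β t (fun σ τ => overlap σ τ ^ 2)
            ≤ C / (N : ℝ) ^ (t / (t + Real.log γ)) := by
  refine ⟨A * γ + 1, by positivity, ?_⟩
  intro N Δ hN _ Edges _ heven ρ hρ hodd hvol t β ht _
  rw [contExp_overlap_sq Edges hρ, discExp_overlap_sq Edges hρ]
  exact ⟨sum_div_sq_le_of_decay hA hγ hN hvol ht fun i j d hd =>
      contCorr_twoPoint_le hρ heven hodd β hd ht,
    sum_div_sq_le_of_decay hA hγ hN hvol ht fun i j d hd =>
      discCorr_twoPoint_le hρ heven hodd β hd ht⟩
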